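/- Assume ψ = ψ_c + δψ with ψ_c'' ≥ λ₀ > 0 and |δψ| + |δψ'| ≤ B, and let L > 0. Then for every K̃ ∈ ℕ there exists a constant C(K̃) > 0 (depending on K̃, ψ and L) such that for every m ∈ ℝ, every a ∈ ℝ^{K̃} with max_i |a_i| ≤ L, and every smooth f ≥ 0 on X_{K̃,m} with ∫ f dμ_{K̃,a,m} = 1, one has |cov_{μ_{K̃,a,m}}(f, (1/K̃)∑_{i=1}^{K̃} ψ'(x_i))|² ≤ C(K̃) ∫ |∇f|²/f dμ_{K̃,a,m}, where ∇f is the tangential gradient of f along X_{K̃,m}. -/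

import Mathlib

open MeasureTheory ENNReal Real

noncomputable section

/-- The canonical ensemble `μ_{K,a,m}` on the hyperplane `X_{K,m}`, with density
`Z⁻¹ exp(-∑ (ψ(xᵢ) + aᵢxᵢ))` with respect to `(K-1)`-dimensional Hausdorff measure. -/
def canonEns (ψ : ℝ → ℝ) (N : ℕ) (a : Fin N → ℝ) (m : ℝ) :
    Measure (EuclideanSpace ℝ (Fin N)) :=
  let ν : Measure (EuclideanSpace ℝ (Fin N)) :=
    ((μH[(N : ℝ) - 1]).restrict {x : EuclideanSpace ℝ (Fin N) | ∑ i, x i = (N : ℝ) * m}).withDensity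
      fun x => ENNReal.ofReal (Real.exp (-(∑ i, (ψ (x i) + a i * x i))))
  (ν Set.univ)⁻¹ • ν

/-- Covariance of two real functions with respect to a measure. -/
def covFn {X : Type*} [MeasurableSpace X] (μ : Measure X) (f g : X → ℝ) : ℝ :=
  (∫ x, f x * g x ∂μ) - (∫ x, f x ∂μ) * (∫ x, g x ∂μ)

/-- `|∇f|²/f` where `∇f` is the tangential gradient along `X_{N,m}`, i.e. the projection of
the Euclidean gradient onto `{v : ∑ vᵢ = 0}`; interpreted as `0` where `f = 0`. -/
def fisherX (N : ℕ) (f : EuclideanSpace ℝ (Fin N) → ℝ) (x : EuclideanSpace ℝ (Fin N)) : ℝ :=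
  if f x = 0 then 0
  else (∑ i, (gradient f x i - (∑ j, gradient f x j) / (N : ℝ)) ^ 2) / f x

/-- A `C¹` potential `u` at bounded `C¹` distance from a strongly convex potential `uc`. -/
structure PerturbedConvex (lam B : ℝ) (u uc : ℝ → ℝ) : Prop where
  smooth : ContDiff ℝ 1 u
  smoothc : ContDiff ℝ 1 uc
  mono : ∀ x y, x ≤ y → lam * (y - x) ≤ deriv uc y - deriv uc x
  close : ∀ x, |u x - uc x| ≤ B
  dclose : ∀ x, |deriv u x - deriv uc x| ≤ B

namespace PerturbedConvex

variable {lam B : ℝ} {u uc : ℝ → ℝ}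

lemma self (h : PerturbedConvex lam B u uc) : PerturbedConvex lam 0 uc uc :=
  ⟨h.smoothc, h.smoothc, h.mono, by simp, by simp⟩

lemma hasDerivAt (h : PerturbedConvex lam B u uc) (x : ℝ) : HasDerivAt u (deriv u x) x :=
  (h.smooth.differentiable one_ne_zero x).hasDerivAt

lemma continuous_deriv (h : PerturbedConvex lam B u uc) : Continuous (deriv u) :=
  h.smooth.continuous_deriv le_rfl

lemma nonneg (h : PerturbedConvex lam B u uc) : 0 ≤ B := (abs_nonneg _).trans (h.close 0)

/-- Reflecting and translating the variable preserves the class. -/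
lemma comp_sub (h : PerturbedConvex lam B u uc) (s : ℝ) :
    PerturbedConvex lam B (fun x => u (s - x)) (fun x => uc (s - x)) := by
  have d : ∀ (w : ℝ → ℝ) x, deriv (fun x => w (s - x)) x = - deriv w (s - x) := fun w x =>
    deriv_comp_const_sub w s x
  refine ⟨h.smooth.comp (by fun_prop), h.smoothc.comp (by fun_prop), fun x y hxy => ?_,
    fun x => h.close _, fun x => ?_⟩
  · rw [d, d]
    have := h.mono (s - y) (s - x) (by linarith)
    linarith
  · rw [d, d, ← abs_neg]
    convert h.dclose (s - x) using 2
    ring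

lemma exp_neg_le (h : PerturbedConvex lam B u uc) (x : ℝ) :
    exp (-u x) ≤ exp B * exp (-uc x) := by
  rw [← exp_add]
  have := abs_le.1 (h.close x)
  exact exp_le_exp.2 (by linarith)

lemma exp_neg_conv_le (h : PerturbedConvex lam B u uc) (x : ℝ) :
    exp (-uc x) ≤ exp B * exp (-u x) := by
  rw [← exp_add]
  have := abs_le.1 (h.close x)
  exact exp_le_exp.2 (by linarith)

lemma four_point (h : PerturbedConvex lam B u uc) {a b c d : ℝ} (hab : a ≤ b) (hac : a ≤ c)
    (hd : a + d = b + c) :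
    exp (-uc a) * exp (-uc d) ≤ exp (-(lam * ((b - a) * (c - a)))) *
      (exp (-uc b) * exp (-uc c)) := by
  have hk : ∀ t, HasDerivAt (fun t => uc (t + (b - a)) - uc t)
      (deriv uc (t + (b - a)) - deriv uc t) t := fun t =>
    ((h.self.hasDerivAt (t + (b - a))).comp_add_const t (b - a)).sub (h.self.hasDerivAt t)
  have key := (convex_univ (𝕜 := ℝ) (E := ℝ)).mul_sub_le_image_sub_of_le_deriv
    (f := fun t => uc (t + (b - a)) - uc t) (C := lam * (b - a))
    (fun t _ => (hk t).continuousAt.continuousWithinAt)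
    (fun t _ => (hk t).differentiableAt.differentiableWithinAt)
    (fun t _ => by
      rw [(hk t).deriv]
      have := h.mono t (t + (b - a)) (by linarith)
      linarith) a trivial c trivial hac
  rw [← exp_add, ← exp_add, ← exp_add]
  have e1 : c + (b - a) = d := by linarith
  have e2 : a + (b - a) = b := by ring
  simp only [e1, e2] at key
  exact exp_le_exp.2 (by linarith)

lemma quadratic_lower (h : PerturbedConvex lam B u uc) (x : ℝ) :
    uc 0 + deriv uc 0 * x + lam / 2 * x ^ 2 ≤ uc x := by
  have hk : ∀ t, HasDerivAt (fun t => uc t - deriv uc 0 * t - lam / 2 * t ^ 2)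
      (deriv uc t - deriv uc 0 - lam * t) t := fun t => by
    have := ((h.self.hasDerivAt t).sub ((hasDerivAt_id t).const_mul (deriv uc 0))).sub
      (((hasDerivAt_id t).pow 2).const_mul (lam / 2))
    convert! this using 1
    simp
    ring
  rcases le_total 0 x with hx | hx
  · have := (convex_Ici (0 : ℝ)).mul_sub_le_image_sub_of_le_deriv (C := 0)
      (fun t _ => (hk t).continuousAt.continuousWithinAt)
      (fun t _ => (hk t).differentiableAt.differentiableWithinAt)
      (fun t ht => by
        rw [(hk t).deriv]
        rw [interior_Ici] at ht
        have := h.mono 0 t (le_of_lt ht)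
        linarith) 0 Set.self_mem_Ici x hx hx
    simp at this
    linarith
  · have := (convex_Iic (0 : ℝ)).image_sub_le_mul_sub_of_deriv_le (C := 0)
      (fun t _ => (hk t).continuousAt.continuousWithinAt)
      (fun t _ => (hk t).differentiableAt.differentiableWithinAt)
      (fun t ht => by
        rw [(hk t).deriv]
        rw [interior_Iic] at ht
        have := h.mono t 0 (le_of_lt ht)
        linarith) x hx 0 Set.self_mem_Iic hx
    simp at this
    linarith

lemma gaussian_bound (h : PerturbedConvex lam B u uc) (hlam : 0 < lam) :
    ∃ A : ℝ, 0 < A ∧ ∀ x, exp (-uc x) ≤ A * exp (-(lam / 4) * x ^ 2) := by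
  refine ⟨exp (-uc 0 + (deriv uc 0) ^ 2 / lam), exp_pos _, fun x => ?_⟩
  rw [← exp_add]
  refine exp_le_exp.2 ?_
  have := h.quadratic_lower x
  have h2 : 0 ≤ (deriv uc 0 + lam / 2 * x) ^ 2 / lam := by positivity
  have h3 : (deriv uc 0 + lam / 2 * x) ^ 2 / lam
    = deriv uc 0 ^ 2 / lam + deriv uc 0 * x + lam / 4 * x ^ 2 := by
    field_simp
    ring
  nlinarith

lemma continuous_exp (h : PerturbedConvex lam B u uc) : Continuous fun x => exp (-u x) :=
  (h.smooth.continuous.neg).rexp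

lemma exists_bound (h : PerturbedConvex lam B u uc) (hlam : 0 < lam) :
    ∃ A : ℝ, ∀ x, exp (-u x) ≤ A := by
  obtain ⟨A, hA, hb⟩ := h.gaussian_bound hlam
  refine ⟨exp B * A, fun x => (h.exp_neg_le x).trans ?_⟩
  gcongr
  refine (hb x).trans (mul_le_of_le_one_right hA.le (exp_le_one_iff.2 ?_))
  nlinarith [sq_nonneg x]

lemma integrable_exp (h : PerturbedConvex lam B u uc) (hlam : 0 < lam) :
    Integrable fun x => exp (-u x) := by
  obtain ⟨A, hA, hb⟩ := h.gaussian_bound hlam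
  refine (((integrable_exp_neg_mul_sq (b := lam / 4) (by positivity)).const_mul A).const_mul
    (exp B)).mono' h.continuous_exp.aestronglyMeasurable (.of_forall fun x => ?_)
  rw [norm_of_nonneg (exp_pos _).le]
  refine (h.exp_neg_le x).trans ?_
  gcongr
  exact hb x

lemma tendsto_exp_atTop (h : PerturbedConvex lam B u uc) (hlam : 0 < lam) :
    Filter.Tendsto (fun x => exp (-uc x)) Filter.atTop (nhds 0) := by
  obtain ⟨A, hA, hb⟩ := h.gaussian_bound hlam
  refine squeeze_zero (fun x => (exp_pos _).le) hb ?_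
  rw [← mul_zero A]
  refine Filter.Tendsto.const_mul A (tendsto_exp_atBot.comp ?_)
  exact (Filter.tendsto_pow_atTop two_ne_zero).const_mul_atTop_of_neg (by linarith)

lemma hasDerivAt_exp (h : PerturbedConvex lam B u uc) (x : ℝ) :
    HasDerivAt (fun x => exp (-u x)) (-(deriv u x * exp (-u x))) x := by
  have := (h.hasDerivAt x).fun_neg.exp
  rwa [mul_neg, mul_comm] at this

lemma exists_deriv_nonneg (h : PerturbedConvex lam B u uc) (hlam : 0 < lam) :
    ∃ x0, ∀ x, x0 ≤ x → 0 ≤ deriv uc x := by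
  refine ⟨|deriv uc 0| / lam, fun x hx => ?_⟩
  rw [div_le_iff₀ hlam] at hx
  have hx0 : 0 ≤ x := by
    by_contra hc
    push Not at hc
    nlinarith [abs_nonneg (deriv uc 0)]
  have := h.mono 0 x hx0
  have := neg_abs_le (deriv uc 0)
  linarith

lemma integrableOn_deriv_conv (h : PerturbedConvex lam B u uc) (hlam : 0 < lam) (b : ℝ) :
    IntegrableOn (fun x => deriv uc x * exp (-uc x)) (Set.Ioi b) := by
  obtain ⟨x0, hx0⟩ := h.exists_deriv_nonneg hlam
  have h1 : IntegrableOn (fun x => deriv uc x * exp (-uc x)) (Set.Ioi (max b x0)) := by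
    have := integrableOn_Ioi_deriv_of_nonpos' (a := max b x0) (l := 0)
      (fun x _ => h.self.hasDerivAt_exp x)
      (fun x hx => neg_nonpos.2 (mul_nonneg (hx0 x ((le_max_right _ _).trans (le_of_lt hx)))
        (exp_pos _).le)) (h.tendsto_exp_atTop hlam)
    simpa using this.neg
  have h2 : IntegrableOn (fun x => deriv uc x * exp (-uc x)) (Set.Ioc b (max b x0)) :=
    (h.self.continuous_deriv.mul h.self.continuous_exp).continuousOn.integrableOn_Icc.mono_set
      Set.Ioc_subset_Icc_self
  rw [← Set.Ioc_union_Ioi_eq_Ioi (le_max_left b x0)]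
  exact h2.union h1

lemma integrable_deriv_conv (h : PerturbedConvex lam B u uc) (hlam : 0 < lam) :
    Integrable (fun x => deriv uc x * exp (-uc x)) := by
  rw [← integrableOn_univ, ← Set.Iic_union_Ioi (a := (0 : ℝ))]
  refine IntegrableOn.union ?_ (h.integrableOn_deriv_conv hlam 0)
  rw [integrableOn_Iic_iff_integrableOn_Iio]
  have := (h.comp_sub 0).integrableOn_deriv_conv hlam 0
  have e : (fun x => deriv (fun y => uc (0 - y)) x * exp (-uc (0 - x)))
    = fun x => (fun x => -(deriv uc x * exp (-uc x))) (-x) := by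
    funext x
    rw [deriv_comp_const_sub]
    simp
  rw [e] at this
  have h2 := IntegrableOn.comp_neg_Iio (c := (0 : ℝ)) (by simpa using this)
  simpa using h2.neg

lemma integrable_deriv (h : PerturbedConvex lam B u uc) (hlam : 0 < lam) :
    Integrable (fun x => deriv u x * exp (-u x)) := by
  refine ((((h.integrable_deriv_conv hlam).norm).add
    ((h.self.integrable_exp hlam).const_mul B)).const_mul (exp B)).mono'
    (h.continuous_deriv.mul h.continuous_exp).aestronglyMeasurable (.of_forall fun x => ?_)
  simp only [norm_mul, norm_eq_abs, abs_exp, Pi.add_apply]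
  calc |deriv u x| * exp (-u x) ≤ (|deriv uc x| + B) * (exp B * exp (-uc x)) := by
        refine mul_le_mul ?_ (h.exp_neg_le x) (exp_pos _).le
          (add_nonneg (abs_nonneg _) h.nonneg)
        have := abs_add_le (deriv uc x) (deriv u x - deriv uc x)
        have := h.dclose x
        rw [show deriv uc x + (deriv u x - deriv uc x) = deriv u x by ring] at *
        linarith
    _ = _ := by ring

end PerturbedConvex

/-- Four-point form of log-concavity. -/
def FourPoint (q : ℝ → ℝ) : Prop :=
  ∀ a b c d, a ≤ b → a ≤ c → a + d = b + c → q a * q d ≤ q b * q c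

lemma lintegral_Iic_deriv_le {φ φ' : ℝ → ℝ} (hd : ∀ x, HasDerivAt φ (φ' x) x)
    (hc : Continuous φ') (x : ℝ) (h0 : ∀ y, 0 ≤ φ y) (h1 : ∀ y ≤ x, 0 ≤ φ' y) :
    ∫⁻ y in Set.Iic x, ENNReal.ofReal (φ' y) ≤ ENNReal.ofReal (φ x) := by
  have hcov : AECover (volume.restrict (Set.Iic x)) Filter.atTop
      (fun n : ℕ => Set.Ioi (x - n)) :=
    aecover_Ioi (Filter.tendsto_atBot_add_const_left _ x
      (Filter.tendsto_neg_atTop_atBot.comp tendsto_natCast_atTop_atTop))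
  refine le_of_tendsto' (hcov.lintegral_tendsto_of_countably_generated
    (f := fun y => ENNReal.ofReal (φ' y)) (by fun_prop)) fun n => ?_
  rw [Measure.restrict_restrict measurableSet_Ioi, Set.Ioi_inter_Iic,
    ← ofReal_integral_eq_lintegral_ofReal]
  · refine ENNReal.ofReal_le_ofReal ?_
    rw [← intervalIntegral.integral_of_le (by simp),
      intervalIntegral.integral_eq_sub_of_hasDerivAt (fun y _ => hd y)
        (hc.intervalIntegrable _ _)]
    linarith [h0 (x - n)]
  · exact hc.integrableOn_Icc.mono_set Set.Ioc_subset_Icc_self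
  · exact (ae_restrict_mem measurableSet_Ioc).mono fun y hy => h1 y hy.2

namespace PerturbedConvex

variable {lam B : ℝ} {u uc : ℝ → ℝ}

lemma lintegral_pair_le (h : PerturbedConvex lam B u uc) (hlam : 0 < lam) {D : ℝ} (hD : 0 ≤ D)
    {x w : ℝ} (hxw : x ≤ w) :
    ∫⁻ y in Set.Iic x, ENNReal.ofReal ((deriv uc (w + (x - y)) - deriv uc y + D) *
        (exp (-uc y) * exp (-uc (w + (x - y))))) ≤
      ENNReal.ofReal ((1 + D * √(π / lam)) * (exp (-uc x) * exp (-uc w))) := by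
  have cg := h.self.continuous_deriv
  have cp := h.self.continuous_exp
  have cu := h.smoothc.continuous
  set φ : ℝ → ℝ := fun y => exp (-uc y) * exp (-uc (w + (x - y))) with hφ
  have hd : ∀ y, HasDerivAt φ ((deriv uc (w + (x - y)) - deriv uc y) * φ y) y := fun y => by
    have h1 := h.self.hasDerivAt_exp y
    have h2 := (h.self.hasDerivAt_exp (w + (x - y))).comp y
      (((hasDerivAt_id y).const_sub x).const_add w)
    refine (h1.mul h2).congr_deriv ?_
    simp only [hφ, Function.comp, id]
    ring
  have h0 : ∀ y, 0 ≤ φ y := fun y => by positivity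
  have hmono : ∀ y ≤ x, 0 ≤ deriv uc (w + (x - y)) - deriv uc y := fun y hy =>
    (mul_nonneg hlam.le (by linarith)).trans (h.mono y (w + (x - y)) (by linarith))
  have hφx : φ x = exp (-uc x) * exp (-uc w) := by simp [hφ]
  have e : ∀ y ∈ Set.Iic x, ENNReal.ofReal ((deriv uc (w + (x - y)) - deriv uc y + D) * φ y) ≤
      ENNReal.ofReal ((deriv uc (w + (x - y)) - deriv uc y) * φ y) +
        ENNReal.ofReal (D * φ x * exp (-lam * (x - y) ^ 2)) := fun y hy => by
    have hy' : y ≤ x := hy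
    rw [← ENNReal.ofReal_add (mul_nonneg (hmono y hy) (h0 y))
      (by have := h0 x; positivity), add_mul]
    refine ENNReal.ofReal_le_ofReal (add_le_add_right ?_ _)
    rw [mul_assoc]
    refine mul_le_mul_of_nonneg_left ?_ hD
    have := h.four_point (a := y) (b := x) (c := w) (d := w + (x - y)) hy' (hy'.trans hxw)
      (by ring)
    rw [hφx, mul_comm (exp (-uc x) * _)]
    refine this.trans ?_
    gcongr
    have : (x - y) * (x - y) ≤ (x - y) * (w - y) :=
      mul_le_mul_of_nonneg_left (by linarith) (by linarith)
    nlinarith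
  calc _ ≤ ∫⁻ y in Set.Iic x, (ENNReal.ofReal ((deriv uc (w + (x - y)) - deriv uc y) * φ y) +
        ENNReal.ofReal (D * φ x * exp (-lam * (x - y) ^ 2))) :=
        setLIntegral_mono (by fun_prop) e
    _ = (∫⁻ y in Set.Iic x, ENNReal.ofReal ((deriv uc (w + (x - y)) - deriv uc y) * φ y)) +
        ∫⁻ y in Set.Iic x, ENNReal.ofReal (D * φ x * exp (-lam * (x - y) ^ 2)) :=
        lintegral_add_left (by fun_prop) _
    _ ≤ ENNReal.ofReal (φ x) + ENNReal.ofReal (D * φ x * √(π / lam)) := by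
        refine add_le_add (lintegral_Iic_deriv_le hd (by fun_prop) x h0
          fun y hy => mul_nonneg (hmono y hy) (h0 y)) ?_
        refine (setLIntegral_le_lintegral _ _).trans ?_
        rw [← ofReal_integral_eq_lintegral_ofReal]
        · refine ENNReal.ofReal_le_ofReal ?_
          rw [integral_const_mul, integral_sub_left_eq_self (fun y => exp (-lam * y ^ 2)),
            integral_gaussian]
        · exact ((integrable_exp_neg_mul_sq hlam).comp_sub_left x).const_mul _
        · exact .of_forall fun y => by have := h0 x; positivity
    _ = _ := by
        rw [← ENNReal.ofReal_add (h0 x) (by have := h0 x; positivity), hφx]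
        congr 1
        ring

lemma lintegral_upper_half_le (h : PerturbedConvex lam B u uc) (hlam : 0 < lam) {D : ℝ}
    (hD : 0 ≤ D) {q : ℝ → ℝ} (hq : FourPoint q) (hq0 : ∀ x, 0 ≤ q x) (hqm : Measurable q)
    (x : ℝ) :
    ∫⁻ y in Set.Iic x, ∫⁻ v in Set.Ici (2 * x - y),
        ENNReal.ofReal ((deriv uc v - deriv uc y + D) *
          ((exp (-uc y) * q y) * (exp (-uc v) * q v))) ≤
      ENNReal.ofReal ((1 + D * √(π / lam)) * (exp (-uc x) * q x)) *
        ∫⁻ w, ENNReal.ofReal (exp (-uc w) * q w) := by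
  have cg := h.self.continuous_deriv.measurable
  have cp := h.self.continuous_exp.measurable
  have cu := h.smoothc.continuous.measurable
  have step1 : ∀ y ∈ Set.Iic x, (∫⁻ v in Set.Ici (2 * x - y),
        ENNReal.ofReal ((deriv uc v - deriv uc y + D) *
          ((exp (-uc y) * q y) * (exp (-uc v) * q v)))) ≤
      ∫⁻ w in Set.Ici x, ENNReal.ofReal (q x * q w) *
        ENNReal.ofReal ((deriv uc (w + (x - y)) - deriv uc y + D) *
        (exp (-uc y) * exp (-uc (w + (x - y))))) := fun y hy => by
    have hy' : y ≤ x := hy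
    have mp := (measurePreserving_add_right (volume : Measure ℝ) (x - y))
    rw [← mp.setLIntegral_comp_preimage measurableSet_Ici (by fun_prop)]
    have e : (fun w => w + (x - y)) ⁻¹' Set.Ici (2 * x - y) = Set.Ici x := by
      ext w
      simp only [Set.mem_preimage, Set.mem_Ici]
      constructor <;> intro <;> linarith
    rw [e]
    refine setLIntegral_mono (by fun_prop) fun w hw => ?_
    have hw' : x ≤ w := hw
    rw [← ENNReal.ofReal_mul (mul_nonneg (hq0 _) (hq0 _))]
    refine ENNReal.ofReal_le_ofReal ?_
    have hm : 0 ≤ deriv uc (w + (x - y)) - deriv uc y :=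
      (mul_nonneg hlam.le (by linarith)).trans (h.mono y (w + (x - y)) (by linarith))
    calc _ = (q y * q (w + (x - y))) * ((deriv uc (w + (x - y)) - deriv uc y + D) *
        (exp (-uc y) * exp (-uc (w + (x - y))))) := by ring
      _ ≤ _ := mul_le_mul_of_nonneg_right
        (hq _ _ _ _ hy' (hy'.trans hw') (by ring)) (by positivity)
  refine (setLIntegral_mono' measurableSet_Iic step1).trans ?_
  rw [lintegral_lintegral_swap (by fun_prop)]
  have step2 : ∀ w ∈ Set.Ici x, (∫⁻ y in Set.Iic x, ENNReal.ofReal (q x * q w) *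
        ENNReal.ofReal ((deriv uc (w + (x - y)) - deriv uc y + D) *
        (exp (-uc y) * exp (-uc (w + (x - y)))))) ≤
      ENNReal.ofReal ((1 + D * √(π / lam)) * (exp (-uc x) * q x)) *
        ENNReal.ofReal (exp (-uc w) * q w) := fun w hw => by
    rw [lintegral_const_mul _ (by fun_prop)]
    refine (mul_le_mul_right (h.lintegral_pair_le hlam hD hw) _).trans ?_
    have hx := hq0 x
    have hw := hq0 w
    rw [← ENNReal.ofReal_mul (by positivity), ← ENNReal.ofReal_mul (by positivity)]
    exact ENNReal.ofReal_le_ofReal (le_of_eq (by ring))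
  refine (setLIntegral_mono (by fun_prop) step2).trans ?_
  rw [lintegral_const_mul _ (by fun_prop)]
  gcongr
  exact Measure.restrict_le_self

end PerturbedConvex

lemma FourPoint.comp_sub {q : ℝ → ℝ} (hq : FourPoint q) (s : ℝ) :
    FourPoint fun x => q (s - x) := fun a b c d hab hac hd => by
  have := hq (s - d) (s - c) (s - b) (s - a) (by linarith) (by linarith) (by linarith)
  linarith

lemma setLIntegral_triangle_swap_le {H : ℝ → ℝ → ℝ≥0∞} (hH : Measurable (Function.uncurry H))
    (x : ℝ) :
    ∫⁻ y in Set.Iic x, ∫⁻ v in Set.Ico x (2 * x - y), H y v ≤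
      ∫⁻ v in Set.Ici x, ∫⁻ y in Set.Iic (2 * x - v), H y v := by
  have m : MeasurableSet {z : ℝ × ℝ | z.1 ≤ x ∧ x ≤ z.2 ∧ z.2 < 2 * x - z.1} := by
    measurability
  calc ∫⁻ y in Set.Iic x, ∫⁻ v in Set.Ico x (2 * x - y), H y v
      = ∫⁻ y, ∫⁻ v, {z : ℝ × ℝ | z.1 ≤ x ∧ x ≤ z.2 ∧ z.2 < 2 * x - z.1}.indicator
          (Function.uncurry H) (y, v) := by
        rw [← lintegral_indicator measurableSet_Iic]
        refine lintegral_congr fun y => ?_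
        by_cases hy : y ≤ x
        · rw [Set.indicator_of_mem (show y ∈ Set.Iic x from hy),
            ← lintegral_indicator measurableSet_Ico]
          refine lintegral_congr fun v => ?_
          simp [Set.indicator_apply, hy, Function.uncurry]
        · rw [Set.indicator_of_notMem (show y ∉ Set.Iic x from hy)]
          simp [hy]
    _ = ∫⁻ v, ∫⁻ y, {z : ℝ × ℝ | z.1 ≤ x ∧ x ≤ z.2 ∧ z.2 < 2 * x - z.1}.indicator
          (Function.uncurry H) (y, v) :=
        lintegral_lintegral_swap (hH.indicator m).aemeasurable
    _ ≤ _ := by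
        rw [← lintegral_indicator measurableSet_Ici]
        refine lintegral_mono fun v => ?_
        by_cases hv : x ≤ v
        · rw [Set.indicator_of_mem (show v ∈ Set.Ici x from hv),
            ← lintegral_indicator measurableSet_Iic]
          refine lintegral_mono fun y => ?_
          simp only [Set.indicator_apply, Set.mem_ofPred_eq, Set.mem_Iic, Function.uncurry]
          split_ifs with h1 h2
          · exact le_rfl
          · exact absurd (by linarith [h1.2.2]) h2
          · exact zero_le
          · exact zero_le
        · simp [hv]

namespace PerturbedConvex

variable {lam B : ℝ} {u uc : ℝ → ℝ}

lemma lintegral_lower_half_le (h : PerturbedConvex lam B u uc) (hlam : 0 < lam) {D : ℝ}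
    (hD : 0 ≤ D) {q : ℝ → ℝ} (hq : FourPoint q) (hq0 : ∀ x, 0 ≤ q x) (hqm : Measurable q)
    (x : ℝ) :
    ∫⁻ v in Set.Ici x, ∫⁻ y in Set.Iic (2 * x - v),
        ENNReal.ofReal ((deriv uc v - deriv uc y + D) *
          ((exp (-uc y) * q y) * (exp (-uc v) * q v))) ≤
      ENNReal.ofReal ((1 + D * √(π / lam)) * (exp (-uc x) * q x)) *
        ∫⁻ w, ENNReal.ofReal (exp (-uc w) * q w) := by
  have cg := h.self.continuous_deriv.measurable
  have cu := h.smoothc.continuous.measurable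
  have key := (h.comp_sub 0).lintegral_upper_half_le hlam hD (hq.comp_sub 0) (fun _ => hq0 _)
    (by fun_prop) (-x)
  have d : ∀ y, deriv (fun x => uc (0 - x)) y = - deriv uc (0 - y) := deriv_comp_const_sub uc 0
  have mp := Measure.measurePreserving_neg (volume : Measure ℝ)
  have e1 : ∫⁻ w, ENNReal.ofReal (exp (-uc (0 - w)) * q (0 - w)) =
      ∫⁻ w, ENNReal.ofReal (exp (-uc w) * q w) :=
    lintegral_sub_left_eq_self (fun w => ENNReal.ofReal (exp (-uc w) * q w)) 0
  rw [e1] at key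
  simp only [d] at key
  simp only [zero_sub, neg_neg] at key
  refine le_trans (le_of_eq ?_) key
  rw [← mp.setLIntegral_comp_preimage measurableSet_Ici]
  · simp only [Set.neg_preimage, Set.neg_Ici]
    refine lintegral_congr fun y => ?_
    rw [← mp.setLIntegral_comp_preimage measurableSet_Iic (by fun_prop)]
    simp only [Set.neg_preimage, Set.neg_Iic]
    rw [show -(2 * x - -y) = 2 * -x - y by ring]
    refine lintegral_congr fun v => ?_
    congr 1
    ring
  · simp only [← lintegral_indicator measurableSet_Iic]
    have : Measurable (Function.uncurry fun v y => {z : ℝ × ℝ | z.2 ≤ 2 * x - z.1}.indicator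
        (fun z => ENNReal.ofReal ((deriv uc z.1 - deriv uc z.2 + D) *
          ((exp (-uc z.2) * q z.2) * (exp (-uc z.1) * q z.1)))) (v, y)) := by
      refine Measurable.indicator (by fun_prop) ?_
      measurability
    exact this.lintegral_prod_right

lemma lintegral_kernel_conv_le (h : PerturbedConvex lam B u uc) (hlam : 0 < lam) {D : ℝ}
    (hD : 0 ≤ D) {q : ℝ → ℝ} (hq : FourPoint q) (hq0 : ∀ x, 0 ≤ q x) (hqm : Measurable q)
    (x : ℝ) :
    ∫⁻ y in Set.Iic x, ∫⁻ v in Set.Ici x,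
        ENNReal.ofReal ((deriv uc v - deriv uc y + D) *
          ((exp (-uc y) * q y) * (exp (-uc v) * q v))) ≤
      2 * (ENNReal.ofReal ((1 + D * √(π / lam)) * (exp (-uc x) * q x)) *
        ∫⁻ w, ENNReal.ofReal (exp (-uc w) * q w)) := by
  have cg := h.self.continuous_deriv.measurable
  have cu := h.smoothc.continuous.measurable
  set H : ℝ → ℝ → ℝ≥0∞ := fun y v => ENNReal.ofReal ((deriv uc v - deriv uc y + D) *
          ((exp (-uc y) * q y) * (exp (-uc v) * q v))) with hH
  have hHm : Measurable (Function.uncurry H) := by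
    simp only [hH, Function.uncurry_def]
    fun_prop
  have hm : Measurable fun y => ∫⁻ v in Set.Ico x (2 * x - y), H y v := by
    simp only [← lintegral_indicator measurableSet_Ico]
    have : Measurable (Function.uncurry fun y v =>
        {z : ℝ × ℝ | x ≤ z.2 ∧ z.2 < 2 * x - z.1}.indicator (Function.uncurry H) (y, v)) := by
      refine Measurable.indicator hHm ?_
      measurability
    exact this.lintegral_prod_right
  calc ∫⁻ y in Set.Iic x, ∫⁻ v in Set.Ici x, H y v
      ≤ ∫⁻ y in Set.Iic x, ((∫⁻ v in Set.Ico x (2 * x - y), H y v) +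
          ∫⁻ v in Set.Ici (2 * x - y), H y v) := by
        refine lintegral_mono fun y => ?_
        refine (lintegral_mono_set (fun v hv => ?_)).trans (lintegral_union_le _ _ _)
        rcases lt_or_ge v (2 * x - y) with h' | h'
        · exact Or.inl ⟨hv, h'⟩
        · exact Or.inr h'
    _ = (∫⁻ y in Set.Iic x, ∫⁻ v in Set.Ico x (2 * x - y), H y v) +
        ∫⁻ y in Set.Iic x, ∫⁻ v in Set.Ici (2 * x - y), H y v := lintegral_add_left hm _
    _ ≤ _ := by
        exact (add_le_add ((setLIntegral_triangle_swap_le hHm x).trans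
          (h.lintegral_lower_half_le hlam hD hq hq0 hqm x))
          (h.lintegral_upper_half_le hlam hD hq hq0 hqm x)).trans (two_mul _).symm.le

/-- The constant in the one-dimensional covariance estimate. -/
def covConst (lam B b : ℝ) : ℝ := exp (4 * (B + b)) * (2 * (1 + 2 * B * √(π / lam)))

lemma lintegral_kernel_le (h : PerturbedConvex lam B u uc) (hlam : 0 < lam) {b : ℝ}
    {q qc : ℝ → ℝ} (hq : FourPoint qc) (hq0 : ∀ x, 0 ≤ q x) (hqc0 : ∀ x, 0 ≤ qc x)
    (hqm : Measurable q) (hqcm : Measurable qc)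
    (h1 : ∀ x, q x ≤ exp b * qc x) (h2 : ∀ x, qc x ≤ exp b * q x) (x : ℝ) :
    ∫⁻ y in Set.Iic x, ∫⁻ v in Set.Ici x,
        ENNReal.ofReal (|deriv u v - deriv u y| *
          ((exp (-u y) * q y) * (exp (-u v) * q v))) ≤
      ENNReal.ofReal (covConst lam B b * (exp (-u x) * q x)) *
        ∫⁻ w, ENNReal.ofReal (exp (-u w) * q w) := by
  have cg := h.self.continuous_deriv.measurable
  have cu := h.smoothc.continuous.measurable
  have cu' := h.smooth.continuous.measurable
  have hB := h.nonneg
  have n1 : ∀ y, exp (-u y) * q y ≤ exp (B + b) * (exp (-uc y) * qc y) := fun y => by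
    calc exp (-u y) * q y ≤ (exp B * exp (-uc y)) * (exp b * qc y) :=
          mul_le_mul (h.exp_neg_le y) (h1 y) (hq0 y) (by positivity)
      _ = _ := by rw [exp_add]; ring
  have n2 : ∀ y, exp (-uc y) * qc y ≤ exp (B + b) * (exp (-u y) * q y) := fun y => by
    calc exp (-uc y) * qc y ≤ (exp B * exp (-u y)) * (exp b * q y) :=
          mul_le_mul (h.exp_neg_conv_le y) (h2 y) (hqc0 y) (by positivity)
      _ = _ := by rw [exp_add]; ring
  have p1 : ∀ y, 0 ≤ exp (-u y) * q y := fun y => mul_nonneg (exp_pos _).le (hq0 y)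
  have p2 : ∀ y, 0 ≤ exp (-uc y) * qc y := fun y => mul_nonneg (exp_pos _).le (hqc0 y)
  have step : ∀ y ∈ Set.Iic x, (∫⁻ v in Set.Ici x, ENNReal.ofReal (|deriv u v - deriv u y| *
          ((exp (-u y) * q y) * (exp (-u v) * q v)))) ≤
      ENNReal.ofReal (exp (B + b) * exp (B + b)) * ∫⁻ v in Set.Ici x,
        ENNReal.ofReal ((deriv uc v - deriv uc y + 2 * B) *
          ((exp (-uc y) * qc y) * (exp (-uc v) * qc v))) := fun y hy => by
    rw [← lintegral_const_mul _ (by fun_prop)]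
    refine setLIntegral_mono (by fun_prop) fun v hv => ?_
    rw [← ENNReal.ofReal_mul (by positivity)]
    refine ENNReal.ofReal_le_ofReal ?_
    have hyv : y ≤ v := le_trans hy hv
    have hm : 0 ≤ deriv uc v - deriv uc y :=
      (mul_nonneg hlam.le (by linarith)).trans (h.mono y v hyv)
    have hg : |deriv u v - deriv u y| ≤ deriv uc v - deriv uc y + 2 * B := by
      have a1 := abs_le.1 (h.dclose v)
      have a2 := abs_le.1 (h.dclose y)
      rw [abs_le]
      constructor <;> linarith
    calc _ ≤ (deriv uc v - deriv uc y + 2 * B) * ((exp (B + b) * (exp (-uc y) * qc y)) *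
          (exp (B + b) * (exp (-uc v) * qc v))) :=
          mul_le_mul hg (mul_le_mul (n1 y) (n1 v) (p1 v)
            (mul_nonneg (exp_pos _).le (p2 y))) (mul_nonneg (p1 y) (p1 v))
            ((abs_nonneg _).trans hg)
      _ = _ := by ring
  have hI : ∫⁻ w, ENNReal.ofReal (exp (-uc w) * qc w) ≤
      ENNReal.ofReal (exp (B + b)) * ∫⁻ w, ENNReal.ofReal (exp (-u w) * q w) := by
    rw [← lintegral_const_mul _ (by fun_prop)]
    refine lintegral_mono fun w => ?_
    rw [← ENNReal.ofReal_mul (by positivity)]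
    exact ENNReal.ofReal_le_ofReal (n2 w)
  refine (setLIntegral_mono' measurableSet_Iic step).trans ?_
  rw [lintegral_const_mul']
  swap
  · exact ENNReal.ofReal_ne_top
  refine (mul_le_mul_right (h.lintegral_kernel_conv_le hlam (D := 2 * B) (by positivity) hq hqc0
    hqcm x) _).trans ?_
  refine (mul_le_mul_right (mul_le_mul_right (mul_le_mul' (ENNReal.ofReal_le_ofReal
    (mul_le_mul_of_nonneg_left (n2 x) (by positivity))) hI) _) _).trans (le_of_eq ?_)
  rw [show (2 : ℝ≥0∞) = ENNReal.ofReal 2 by simp]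
  have hx := p1 x
  rw [← mul_assoc (ENNReal.ofReal (_ * (_ * _))), ← ENNReal.ofReal_mul (by positivity),
    ← mul_assoc, ← mul_assoc, ← ENNReal.ofReal_mul (by positivity),
    ← ENNReal.ofReal_mul (by positivity)]
  congr 2
  have e4 : exp (4 * (B + b)) = exp (B + b) ^ 4 := by
    rw [← exp_nat_mul]
    norm_num
  rw [covConst, e4]
  ring

end PerturbedConvex

lemma abs_covariance_le_of_kernel {ν g F K : ℝ → ℝ} {C : ℝ} (hC : 0 ≤ C)
    (hν0 : ∀ x, 0 ≤ ν x) (hνm : Measurable ν) (hgm : Measurable g) (hKm : Continuous K)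
    (hK0 : ∀ x, 0 ≤ K x) (hF : ∀ a b, a ≤ b → |F b - F a| ≤ ∫ x in a..b, K x)
    (hν : Integrable ν) (hFν : Integrable fun x => F x * ν x)
    (hgν : Integrable fun x => g x * ν x) (hFgν : Integrable fun x => F x * g x * ν x)
    (hKν : Integrable fun x => K x * ν x)
    (hker : ∀ x, ∫⁻ y in Set.Iic x, ∫⁻ v in Set.Ici x,
      ENNReal.ofReal (|g v - g y| * (ν y * ν v)) ≤
        ENNReal.ofReal (C * ν x) * ∫⁻ w, ENNReal.ofReal (ν w)) :
    |(∫ x, ν x) * (∫ x, F x * g x * ν x) - (∫ x, F x * ν x) * (∫ x, g x * ν x)| ≤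
      C * ((∫ x, ν x) * ∫ x, K x * ν x) := by
  have hKm' := hKm.measurable
  set E : ℝ × ℝ → ℝ := fun z => (F z.2 - F z.1) * (g z.2 - g z.1) * (ν z.1 * ν z.2) with hE
  set S : ℝ → ℝ → ℝ → ℝ≥0∞ := fun x y v => {z : ℝ × ℝ × ℝ | z.2.1 ≤ z.1 ∧ z.1 ≤ z.2.2}.indicator
    (fun z => ENNReal.ofReal (K z.1) *
      ENNReal.ofReal (|g z.2.2 - g z.2.1| * (ν z.2.1 * ν z.2.2))) (x, y, v) with hS
  have hset : MeasurableSet {z : ℝ × ℝ × ℝ | z.2.1 ≤ z.1 ∧ z.1 ≤ z.2.2} := by measurability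
  have hSm : Measurable fun z : ℝ × ℝ × ℝ => S z.1 z.2.1 z.2.2 :=
    Measurable.indicator (by fun_prop) hset
  have hTm : Measurable fun z : ℝ × ℝ => ∫⁻ x, S x z.1 z.2 := by
    have : Measurable (Function.uncurry fun (x : ℝ) (z : ℝ × ℝ) => S x z.1 z.2) := hSm
    exact this.lintegral_prod_left
  have hcov : ∫ z, E z = 2 * ((∫ x, ν x) * (∫ x, F x * g x * ν x) -
      (∫ x, F x * ν x) * (∫ x, g x * ν x)) := by
    have e : E = fun z => ((ν z.1 * (F z.2 * g z.2 * ν z.2) + (F z.1 * g z.1 * ν z.1) * ν z.2) -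
        ((F z.1 * ν z.1) * (g z.2 * ν z.2) + (g z.1 * ν z.1) * (F z.2 * ν z.2))) := by
      funext z
      simp only [hE]
      ring
    rw [e, Measure.volume_eq_prod]
    beta_reduce
    rw [integral_sub ((hν.mul_prod hFgν).fun_add (hFgν.mul_prod hν))
      ((hFν.mul_prod hgν).fun_add (hgν.mul_prod hFν)), integral_add (hν.mul_prod hFgν)
      (hFgν.mul_prod hν), integral_add (hFν.mul_prod hgν) (hgν.mul_prod hFν),
      integral_prod_mul ν (fun x => F x * g x * ν x),
      integral_prod_mul (fun x => F x * g x * ν x) ν,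
      integral_prod_mul (fun x => F x * ν x) (fun x => g x * ν x),
      integral_prod_mul (fun x => g x * ν x) (fun x => F x * ν x)]
    ring
  have hpt : ∀ y v, y ≤ v → ‖E (y, v)‖ₑ ≤ ∫⁻ x, S x y v := fun y v hyv => by
    have e1 : (∫⁻ x, S x y v) = (∫⁻ x in Set.Icc y v, ENNReal.ofReal (K x)) *
        ENNReal.ofReal (|g v - g y| * (ν y * ν v)) := by
      rw [← lintegral_mul_const _ (by fun_prop), ← lintegral_indicator measurableSet_Icc]
      refine lintegral_congr fun x => ?_
      simp [hS, Set.indicator_apply]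
    rw [e1, ← ofReal_integral_eq_lintegral_ofReal (hKm.integrableOn_Icc)
      (.of_forall hK0), integral_Icc_eq_integral_Ioc, ← intervalIntegral.integral_of_le hyv,
      ← ENNReal.ofReal_mul ((abs_nonneg _).trans (hF y v hyv)), ← ofReal_norm]
    refine ENNReal.ofReal_le_ofReal ?_
    simp only [hE, norm_mul, norm_eq_abs, abs_of_nonneg (hν0 y), abs_of_nonneg (hν0 v)]
    rw [mul_assoc]
    exact mul_le_mul_of_nonneg_right (hF y v hyv)
      (mul_nonneg (abs_nonneg _) (mul_nonneg (hν0 _) (hν0 _)))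
  have hpt2 : ∀ z : ℝ × ℝ, ‖E z‖ₑ ≤ (∫⁻ x, S x z.1 z.2) + ∫⁻ x, S x z.2 z.1 := fun z => by
    rcases le_total z.1 z.2 with h | h
    · exact (hpt _ _ h).trans le_self_add
    · refine le_trans ?_ ((hpt _ _ h).trans le_add_self)
      refine le_of_eq (congrArg _ ?_)
      simp only [hE]
      ring
  have hone : ∫⁻ z : ℝ × ℝ, (∫⁻ x, S x z.1 z.2) ≤
      ENNReal.ofReal (C * ((∫ x, ν x) * ∫ x, K x * ν x)) := by
    calc _ = ∫⁻ x, ∫⁻ z : ℝ × ℝ, S x z.1 z.2 :=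
          lintegral_lintegral_swap
            (f := fun (z : ℝ × ℝ) x => S x z.1 z.2)
            (hSm.comp measurable_swap).aemeasurable
      _ = ∫⁻ x, ENNReal.ofReal (K x) * ∫⁻ y in Set.Iic x, ∫⁻ v in Set.Ici x,
            ENNReal.ofReal (|g v - g y| * (ν y * ν v)) := by
          refine lintegral_congr fun x => ?_
          rw [Measure.volume_eq_prod, lintegral_prod (fun z : ℝ × ℝ => S x z.1 z.2)
            (hSm.comp measurable_prodMk_left).aemeasurable,
            ← lintegral_const_mul' _ _ ENNReal.ofReal_ne_top,
            ← lintegral_indicator measurableSet_Iic]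
          refine lintegral_congr fun y => ?_
          by_cases hy : y ≤ x
          · rw [Set.indicator_of_mem (show y ∈ Set.Iic x from hy),
              ← lintegral_const_mul _ (by fun_prop), ← lintegral_indicator measurableSet_Ici]
            refine lintegral_congr fun v => ?_
            simp [hS, Set.indicator_apply, hy]
          · rw [Set.indicator_of_notMem (show y ∉ Set.Iic x from hy)]
            simp [hS, hy]
      _ ≤ ∫⁻ x, ENNReal.ofReal (C * (∫ x, ν x)) * ENNReal.ofReal (K x * ν x) := by
          refine lintegral_mono fun x => ?_
          refine (mul_le_mul_right (hker x) _).trans (le_of_eq ?_)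
          rw [← ofReal_integral_eq_lintegral_ofReal hν (.of_forall hν0),
            ← ENNReal.ofReal_mul (mul_nonneg hC (hν0 x)), ← ENNReal.ofReal_mul (hK0 x),
            ← ENNReal.ofReal_mul (mul_nonneg hC (integral_nonneg hν0))]
          congr 1
          ring
      _ = _ := by
          rw [lintegral_const_mul _ (by fun_prop), ← ofReal_integral_eq_lintegral_ofReal hKν
            (.of_forall fun x => mul_nonneg (hK0 x) (hν0 x)),
            ← ENNReal.ofReal_mul (mul_nonneg hC (integral_nonneg hν0)), mul_assoc]
  have htwo : ∫⁻ z : ℝ × ℝ, (∫⁻ x, S x z.2 z.1) ≤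
      ENNReal.ofReal (C * ((∫ x, ν x) * ∫ x, K x * ν x)) := by
    refine le_trans (le_of_eq ?_) hone
    exact (Measure.measurePreserving_swap (μ := (volume : Measure ℝ))
      (ν := (volume : Measure ℝ))).lintegral_comp (f := fun z : ℝ × ℝ => ∫⁻ x, S x z.1 z.2) hTm
  have hpos : 0 ≤ C * ((∫ x, ν x) * ∫ x, K x * ν x) :=
    mul_nonneg hC (mul_nonneg (integral_nonneg hν0)
      (integral_nonneg fun x => mul_nonneg (hK0 x) (hν0 x)))
  have hfin : ENNReal.ofReal |∫ z, E z| ≤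
      ENNReal.ofReal (2 * (C * ((∫ x, ν x) * ∫ x, K x * ν x))) := by
    calc ENNReal.ofReal |∫ z, E z| = ‖∫ z, E z‖ₑ := by rw [← ofReal_norm, norm_eq_abs]
      _ ≤ ∫⁻ z, ‖E z‖ₑ := enorm_integral_le_lintegral_enorm _
      _ ≤ ∫⁻ z : ℝ × ℝ, ((∫⁻ x, S x z.1 z.2) + ∫⁻ x, S x z.2 z.1) := lintegral_mono hpt2
      _ = _ := lintegral_add_left hTm _
      _ ≤ _ := add_le_add hone htwo
      _ = _ := by rw [← ENNReal.ofReal_add hpos hpos, two_mul]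
  have := (ENNReal.ofReal_le_ofReal_iff (by positivity)).1 hfin
  rw [hcov, abs_mul, abs_two] at this
  linarith

lemma PerturbedConvex.abs_covariance_le {lam B b : ℝ} {u uc q qc F K : ℝ → ℝ}
    (h : PerturbedConvex lam B u uc) (hlam : 0 < lam)
    (hq : FourPoint qc) (hq0 : ∀ x, 0 ≤ q x) (hqc0 : ∀ x, 0 ≤ qc x)
    (hqm : Continuous q) (hqcm : Continuous qc) {A : ℝ} (hqA : ∀ x, q x ≤ A)
    (h1 : ∀ x, q x ≤ exp b * qc x) (h2 : ∀ x, qc x ≤ exp b * q x)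
    (hFc : Continuous F) {A' : ℝ} (hFA : ∀ x, |F x| ≤ A') (hKm : Continuous K)
    (hK0 : ∀ x, 0 ≤ K x) (hF : ∀ a b, a ≤ b → |F b - F a| ≤ ∫ x in a..b, K x)
    (hKν : Integrable fun x => K x * (exp (-u x) * q x)) :
    |(∫ x, exp (-u x) * q x) * (∫ x, F x * deriv u x * (exp (-u x) * q x)) -
        (∫ x, F x * (exp (-u x) * q x)) * (∫ x, deriv u x * (exp (-u x) * q x))| ≤
      covConst lam B b * ((∫ x, exp (-u x) * q x) * ∫ x, K x * (exp (-u x) * q x)) := by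
  have hB := h.nonneg
  have i1 : Integrable fun x => exp (-u x) * q x :=
    (h.integrable_exp hlam).mul_bdd (c := A) hqm.aestronglyMeasurable
      (.of_forall fun x => by rw [norm_of_nonneg (hq0 x)]; exact hqA x)
  have i2 : Integrable fun x => deriv u x * (exp (-u x) * q x) := by
    simpa only [mul_assoc] using
      (h.integrable_deriv hlam).mul_bdd (c := A) hqm.aestronglyMeasurable
      (.of_forall fun x => by rw [norm_of_nonneg (hq0 x)]; exact hqA x)
  refine abs_covariance_le_of_kernel (by unfold covConst; positivity)
    (fun x => mul_nonneg (exp_pos _).le (hq0 x)) (h.continuous_exp.mul hqm).measurable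
    h.continuous_deriv.measurable hKm hK0 hF i1
    (i1.bdd_mul (c := A') hFc.aestronglyMeasurable (.of_forall hFA)) i2 ?_ hKν
    (fun x => h.lintegral_kernel_le hlam hq hq0 hqc0 hqm.measurable hqcm.measurable h1 h2 x)
  simpa only [mul_assoc] using i2.bdd_mul (c := A') hFc.aestronglyMeasurable (.of_forall hFA)

/-- Convolution preserves the four-point inequality. -/
lemma FourPoint.convolution {f g : ℝ → ℝ} (hf : FourPoint f) (hg : FourPoint g)
    (hfi : Integrable f) (hgc : Continuous g) {A : ℝ} (hgA : ∀ x, |g x| ≤ A) :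
    FourPoint fun s => ∫ t, f (s - t) * g t := by
  intro a b c d hab hac hd
  set δ := b - a with hδ
  have hshift : ∀ s, (∫ t, f (s - δ - t) * g t) = ∫ t, f (s - t) * g (t - δ) := fun s => by
    rw [← integral_sub_right_eq_self (fun t => f (s - δ - t) * g t) δ]
    refine integral_congr_ae (.of_forall fun t => ?_)
    simp only
    congr 2
    ring
  have ea : a = b - δ := by rw [hδ]; ring
  have ec : c = d - δ := by rw [hδ]; linarith
  have hI : ∀ s r, Integrable fun t => f (s - t) * g (t - r) := fun s r =>
    (hfi.comp_sub_left s).mul_bdd (c := A) (by fun_prop) (.of_forall fun t => hgA _)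
  have i11 : Integrable fun t => f (b - t) * g t := by simpa using hI b 0
  have i21 : Integrable fun t => f (d - t) * g t := by simpa using hI d 0
  have i12 := hI b δ
  have i22 := hI d δ
  simp only
  rw [ec, ea, hshift, hshift]
  have key : 0 ≤ ∫ z : ℝ × ℝ, ((f (b - z.1) * f (d - z.2) - f (b - z.2) * f (d - z.1)) *
      (g z.1 * g (z.2 - δ) - g (z.1 - δ) * g z.2)) := by
    refine integral_nonneg fun z => ?_
    rcases le_total z.1 z.2 with h | h
    · refine mul_nonneg (sub_nonneg.2 ?_) (sub_nonneg.2 ?_)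
      · exact hf _ _ _ _ (by linarith) (by linarith) (by linarith)
      · exact hg _ _ _ _ (by linarith) (by linarith) (by linarith)
    · refine mul_nonneg_of_nonpos_of_nonpos (sub_nonpos.2 ?_) (sub_nonpos.2 ?_)
      · exact hf _ _ _ _ (by linarith) (by linarith) (by linarith)
      · rw [mul_comm (g z.1), mul_comm (g (z.1 - δ))]
        exact hg _ _ _ _ (by linarith) (by linarith) (by linarith)
  have e : (fun z : ℝ × ℝ => (f (b - z.1) * f (d - z.2) - f (b - z.2) * f (d - z.1)) *
      (g z.1 * g (z.2 - δ) - g (z.1 - δ) * g z.2)) = fun z =>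
      ((f (b - z.1) * g z.1) * (f (d - z.2) * g (z.2 - δ)) +
        (f (d - z.1) * g (z.1 - δ)) * (f (b - z.2) * g z.2)) -
      ((f (b - z.1) * g (z.1 - δ)) * (f (d - z.2) * g z.2) +
        (f (d - z.1) * g z.1) * (f (b - z.2) * g (z.2 - δ))) := by
    funext z
    ring
  rw [e, Measure.volume_eq_prod, integral_sub ((i11.mul_prod i22).fun_add (i22.mul_prod i11))
    ((i12.mul_prod i21).fun_add (i21.mul_prod i12)),
    integral_add (i11.mul_prod i22) (i22.mul_prod i11),
    integral_add (i12.mul_prod i21) (i21.mul_prod i12),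
    integral_prod_mul (fun t => f (b - t) * g t) (fun t => f (d - t) * g (t - δ)),
    integral_prod_mul (fun t => f (d - t) * g (t - δ)) (fun t => f (b - t) * g t),
    integral_prod_mul (fun t => f (b - t) * g (t - δ)) (fun t => f (d - t) * g t),
    integral_prod_mul (fun t => f (d - t) * g t) (fun t => f (b - t) * g (t - δ))] at key
  nlinarith

/-- Differentiation of a convolution `p ⋆ q` when `p` and its derivative are in `L¹` and `q` is
bounded. -/
lemma hasDerivAt_convolution_of_integrable {p p' q : ℝ → ℝ} (hp : ∀ x, HasDerivAt p (p' x) x)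
    (hc : Continuous p') (hpi : Integrable p) (hpi' : Integrable p') (hq : Continuous q)
    {A : ℝ} (hA : ∀ x, |q x| ≤ A) (s : ℝ) :
    HasDerivAt (fun s => ∫ t, p (s - t) * q t) (∫ t, p' (s - t) * q t) s := by
  have hI : ∀ s, Integrable fun t => p (s - t) * q t := fun s =>
    (hpi.comp_sub_left s).mul_bdd (c := A) hq.aestronglyMeasurable (.of_forall hA)
  have hI' : ∀ s, Integrable fun t => p' (s - t) * q t := fun s =>
    (hpi'.comp_sub_left s).mul_bdd (c := A) hq.aestronglyMeasurable (.of_forall hA)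
  have hA0 : 0 ≤ A := (abs_nonneg _).trans (hA 0)
  have hD : Continuous fun r => ∫ t, p' (r - t) * q t := by
    have e : (fun r => ∫ t, p' (r - t) * q t) = fun r => ∫ x, p' x * q (r - x) := by
      funext r
      rw [← integral_sub_left_eq_self (fun x => p' x * q (r - x)) _ r]
      simp
    rw [e]
    refine continuous_of_dominated (bound := fun x => ‖p' x‖ * A)
      (fun r => by fun_prop) (fun r => .of_forall fun x => ?_) (hpi'.norm.mul_const A)
      (.of_forall fun x => by fun_prop)
    rw [norm_mul]
    exact mul_le_mul_of_nonneg_left (hA _) (norm_nonneg _)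
  have hswap : ∀ s, (∫ t, p (s - t) * q t) =
      (∫ t, p (0 - t) * q t) + ∫ r in (0 : ℝ)..s, ∫ t, p' (r - t) * q t := fun s => by
    have hprod : Integrable (Function.uncurry fun r t => p' (r - t) * q t)
        ((volume.restrict (Set.uIoc 0 s)).prod volume) := by
      have : IsFiniteMeasure (volume.restrict (Set.uIoc (0 : ℝ) s)) :=
        ⟨by rw [Measure.restrict_apply_univ]; simp [Set.uIoc]⟩
      refine (integrable_prod_iff ?_).2 ⟨.of_forall fun r => hI' r, ?_⟩
      · have : Continuous (Function.uncurry fun r t : ℝ => p' (r - t) * q t) := by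
          simp only [Function.uncurry_def]
          fun_prop
        exact this.aestronglyMeasurable
      · refine Integrable.mono' (g := fun _ => (∫ x, ‖p' x‖) * A)
          (integrable_const _) ?_ (.of_forall fun r => ?_)
        · have : Continuous (Function.uncurry fun r t : ℝ => ‖p' (r - t) * q t‖) := by
            simp only [Function.uncurry_def]
            fun_prop
          exact (this.stronglyMeasurable.integral_prod_right).aestronglyMeasurable
        · rw [norm_of_nonneg (integral_nonneg fun _ => norm_nonneg _)]
          have e2 : (∫ x, ‖p' x‖) = ∫ t, ‖p' (r - t)‖ :=
            (integral_sub_left_eq_self (fun x => ‖p' x‖) volume r).symm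
          rw [e2, ← integral_mul_const]
          refine integral_mono (hI' r).norm ((hpi'.comp_sub_left r).norm.mul_const A)
            fun t => ?_
          simp only [Function.uncurry_apply_pair, norm_mul]
          exact mul_le_mul_of_nonneg_left (hA _) (norm_nonneg _)
    rw [intervalIntegral_integral_swap hprod, ← integral_add (hI 0)]
    · refine integral_congr_ae (.of_forall fun t => ?_)
      simp only
      have hder : ∀ r ∈ Set.uIcc 0 s, HasDerivAt (fun r => p (r - t) * q t)
          (p' (r - t) * q t) r := fun r _ => ((hp (r - t)).comp_sub_const r t).mul_const (q t)
      rw [intervalIntegral.integral_eq_sub_of_hasDerivAt hder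
        (Continuous.intervalIntegrable (by fun_prop) _ _)]
      ring
    · have hh : ∀ t, (∫ r in (0 : ℝ)..s, p' (r - t) * q t) = p (s - t) * q t - p (0 - t) * q t :=
        fun t => intervalIntegral.integral_eq_sub_of_hasDerivAt
          (f := fun r => p (r - t) * q t)
          (fun r _ => ((hp (r - t)).comp_sub_const r t).mul_const (q t))
          (Continuous.intervalIntegrable (by fun_prop) _ _)
      simp only [hh]
      exact (hI s).sub (hI 0)
  rw [funext hswap]
  exact (intervalIntegral.integral_hasDerivAt_right (hD.intervalIntegrable _ _)
    hD.aestronglyMeasurable.stronglyMeasurableAtFilter hD.continuousAt).const_add _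

/-- The point of `ℝ^{k+1}` with coordinate sum `t` and last `k` coordinates `z`. -/
def sumCons {k : ℕ} (t : ℝ) (z : Fin k → ℝ) : Fin (k + 1) → ℝ := Fin.cons (t - ∑ i, z i) z

@[simp] lemma sumCons_zero {k : ℕ} (t : ℝ) (z : Fin k → ℝ) : sumCons t z 0 = t - ∑ i, z i := rfl

@[simp] lemma sumCons_succ {k : ℕ} (t : ℝ) (z : Fin k → ℝ) (i : Fin k) :
    sumCons t z i.succ = z i := rfl

lemma sum_sumCons {k : ℕ} (t : ℝ) (z : Fin k → ℝ) : ∑ i, sumCons t z i = t := by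
  simp [Fin.sum_univ_succ]

lemma continuous_sumCons {k : ℕ} :
    Continuous fun p : ℝ × (Fin k → ℝ) => (sumCons p.1 p.2 : Fin (k + 1) → ℝ) := by
  refine continuous_pi fun i => ?_
  refine Fin.cases ?_ (fun j => ?_) i
  · simp only [sumCons_zero]
    fun_prop
  · simp only [sumCons_succ]
    fun_prop

lemma measurePreserving_sumCons {k : ℕ} :
    MeasurePreserving (fun p : ℝ × (Fin k → ℝ) => (sumCons p.1 p.2 : Fin (k + 1) → ℝ))
      (volume.prod volume) volume := by
  have h1 : MeasurePreserving (fun p : (Fin k → ℝ) × ℝ => (p.1, p.2 - ∑ i, p.1 i))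
      (volume.prod volume) (volume.prod volume) :=
    (MeasurePreserving.id _).skew_product (g := fun (z : Fin k → ℝ) (t : ℝ) => t - ∑ i, z i)
      (by simp only [Function.uncurry_def]; fun_prop)
      (.of_forall fun z => (measurePreserving_sub_right volume (∑ i, z i)).map_eq)
  have hs : ∀ {α β : Type} [MeasureSpace α] [MeasureSpace β] [SigmaFinite (volume : Measure α)]
      [SigmaFinite (volume : Measure β)], MeasurePreserving (Prod.swap : α × β → β × α)
      (volume.prod volume) (volume.prod volume) := ⟨measurable_swap, Measure.prod_swap⟩
  have h2 := (volume_preserving_piFinSuccAbove (fun _ : Fin (k + 1) => ℝ) 0).symm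
  have h3 := h2.comp (hs.comp (h1.comp hs))
  have e : (fun p : ℝ × (Fin k → ℝ) => (sumCons p.1 p.2 : Fin (k + 1) → ℝ)) =
      (MeasurableEquiv.piFinSuccAbove (fun _ : Fin (k + 1) => ℝ) 0).symm ∘ Prod.swap ∘
        (fun p : (Fin k → ℝ) × ℝ => (p.1, p.2 - ∑ i, p.1 i)) ∘ Prod.swap := by
    funext p i
    refine Fin.cases ?_ (fun j => ?_) i
    · simp [MeasurableEquiv.piFinSuccAbove]
    · simp [MeasurableEquiv.piFinSuccAbove]
  rw [e]
  exact h3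

lemma measurableEmbedding_sumCons {k : ℕ} :
    MeasurableEmbedding fun p : ℝ × (Fin k → ℝ) => (sumCons p.1 p.2 : Fin (k + 1) → ℝ) := by
  refine continuous_sumCons.measurableEmbedding fun p q h => ?_
  simp only at h
  refine Prod.ext ?_ (funext fun i => ?_)
  · rw [← sum_sumCons p.1 p.2, h, sum_sumCons]
  · simpa using congrFun h i.succ

/-- The product Boltzmann weight of the potentials `u i`. -/
def boltz {k : ℕ} (u : Fin k → ℝ → ℝ) (z : Fin k → ℝ) : ℝ := ∏ i, exp (-u i (z i))

/-- The canonical weight at total sum `s`, the slack coordinate having potential `v`. -/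
def canWeight {k : ℕ} (v : ℝ → ℝ) (u : Fin k → ℝ → ℝ) (s : ℝ) (z : Fin k → ℝ) : ℝ :=
  exp (-v (s - ∑ i, z i)) * boltz u z

/-- The canonical partition function. -/
def partFn {k : ℕ} (v : ℝ → ℝ) (u : Fin k → ℝ → ℝ) (s : ℝ) : ℝ := ∫ z, canWeight v u s z

lemma boltz_pos {k : ℕ} (u : Fin k → ℝ → ℝ) (z : Fin k → ℝ) : 0 < boltz u z :=
  Finset.prod_pos fun _ _ => exp_pos _

lemma canWeight_pos {k : ℕ} (v : ℝ → ℝ) (u : Fin k → ℝ → ℝ) (s : ℝ) (z : Fin k → ℝ) :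
    0 < canWeight v u s z := mul_pos (exp_pos _) (boltz_pos _ _)

lemma canWeight_sumCons {k : ℕ} (v : ℝ → ℝ) (u : Fin (k + 1) → ℝ → ℝ) (s t : ℝ)
    (z : Fin k → ℝ) :
    canWeight v u s (sumCons t z) = exp (-v (s - t)) * canWeight (u 0) (Fin.tail u) t z := by
  simp only [canWeight, boltz, sum_sumCons, Fin.prod_univ_succ, sumCons_zero, sumCons_succ,
    Fin.tail]

section Canonical

variable {k : ℕ} {lam B : ℝ} {v vc : ℝ → ℝ} {u uc : Fin k → ℝ → ℝ}

lemma continuous_boltz (hu : ∀ i, PerturbedConvex lam B (u i) (uc i)) : Continuous (boltz u) :=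
  continuous_finsetProd _ fun i _ => (hu i).continuous_exp.comp (continuous_apply i)

lemma integrable_boltz (hlam : 0 < lam) (hu : ∀ i, PerturbedConvex lam B (u i) (uc i)) :
    Integrable (boltz u) :=
  Integrable.fintype_prod fun i => (hu i).integrable_exp hlam

lemma continuous_canWeight (hv : PerturbedConvex lam B v vc)
    (hu : ∀ i, PerturbedConvex lam B (u i) (uc i)) :
    Continuous fun p : ℝ × (Fin k → ℝ) => canWeight v u p.1 p.2 := by
  have h1 := hv.continuous_exp
  have h2 := continuous_boltz hu
  unfold canWeight
  exact (h1.comp (by fun_prop : Continuous fun p : ℝ × (Fin k → ℝ) => p.1 - ∑ i, p.2 i)).mul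
    (h2.comp continuous_snd)

/-- Integrals of `h (sumCons t z)` against the product weight are continuous in `t`. -/
lemma continuous_integral_sumCons (hlam : 0 < lam) (hu : ∀ i, PerturbedConvex lam B (u i) (uc i))
    {h : (Fin (k + 1) → ℝ) → ℝ} (hc : Continuous h) {A : ℝ} (hA : ∀ y, |h y| ≤ A) :
    Continuous fun t => ∫ z, h (sumCons t z) * boltz u z := by
  refine continuous_of_dominated (bound := fun z => A * boltz u z) (fun t => ?_)
    (fun t => .of_forall fun z => ?_) ((integrable_boltz hlam hu).const_mul A)
    (.of_forall fun z => ?_)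
  · exact ((hc.comp (continuous_sumCons.comp (by fun_prop : Continuous fun z : Fin k → ℝ =>
      (t, z)))).mul (continuous_boltz hu)).aestronglyMeasurable
  · rw [norm_mul, norm_of_nonneg (boltz_pos _ _).le]
    exact mul_le_mul_of_nonneg_right (hA _) (boltz_pos _ _).le
  · exact (hc.comp (continuous_sumCons.comp (by fun_prop : Continuous fun t : ℝ =>
      (t, z)))).mul continuous_const

lemma integrable_sumCons_mul_boltz (hlam : 0 < lam)
    (hu : ∀ i, PerturbedConvex lam B (u i) (uc i))
    {h : (Fin (k + 1) → ℝ) → ℝ} (hc : Continuous h) {A : ℝ} (hA : ∀ y, |h y| ≤ A) (t : ℝ) :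
    Integrable fun z => h (sumCons t z) * boltz u z :=
  (integrable_boltz hlam hu).bdd_mul (c := A)
    (hc.comp (continuous_sumCons.comp (by fun_prop : Continuous fun z : Fin k → ℝ =>
      (t, z)))).aestronglyMeasurable (.of_forall fun _ => hA _)

lemma hasDerivAt_integral_sumCons (hlam : 0 < lam)
    (hu : ∀ i, PerturbedConvex lam B (u i) (uc i))
    {h h' : (Fin (k + 1) → ℝ) → ℝ} (hc : Continuous h) {A : ℝ} (hA : ∀ y, |h y| ≤ A)
    (hc' : Continuous h') {A' : ℝ} (hA' : ∀ y, |h' y| ≤ A')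
    (hd : ∀ t z, HasDerivAt (fun t => h (sumCons t z)) (h' (sumCons t z)) t) (t : ℝ) :
    HasDerivAt (fun t => ∫ z, h (sumCons t z) * boltz u z)
      (∫ z, h' (sumCons t z) * boltz u z) t := by
  refine (hasDerivAt_integral_of_dominated_loc_of_deriv_le (s := Set.univ)
    (bound := fun z => A' * boltz u z) Filter.univ_mem (.of_forall fun r => ?_) ?_
    ?_ (.of_forall fun z r _ => ?_) ((integrable_boltz hlam hu).const_mul A')
    (.of_forall fun z r _ => (hd r z).mul_const _)).2
  · exact (integrable_sumCons_mul_boltz hlam hu hc hA r).aestronglyMeasurable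
  · exact integrable_sumCons_mul_boltz hlam hu hc hA t
  · exact (integrable_sumCons_mul_boltz hlam hu hc' hA' t).aestronglyMeasurable
  · rw [norm_mul, norm_of_nonneg (boltz_pos _ _).le]
    exact mul_le_mul_of_nonneg_right (hA' _) (boltz_pos _ _).le

lemma integrable_canWeight (hlam : 0 < lam) (hv : PerturbedConvex lam B v vc)
    (hu : ∀ i, PerturbedConvex lam B (u i) (uc i)) (s : ℝ) : Integrable (canWeight v u s) := by
  obtain ⟨A, hA⟩ := hv.exists_bound hlam
  refine integrable_sumCons_mul_boltz hlam hu (h := fun y => exp (-v (y 0)))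
    (hv.continuous_exp.comp (continuous_apply 0)) (A := A) (fun y => ?_) s
  rw [abs_exp]
  exact hA _

lemma continuous_partFn (hlam : 0 < lam) (hv : PerturbedConvex lam B v vc)
    (hu : ∀ i, PerturbedConvex lam B (u i) (uc i)) : Continuous (partFn v u) := by
  obtain ⟨A, hA⟩ := hv.exists_bound hlam
  refine continuous_integral_sumCons hlam hu (h := fun y => exp (-v (y 0)))
    (hv.continuous_exp.comp (continuous_apply 0)) (A := A) (fun y => ?_)
  rw [abs_exp]
  exact hA _

lemma partFn_pos (hlam : 0 < lam) (hv : PerturbedConvex lam B v vc)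
    (hu : ∀ i, PerturbedConvex lam B (u i) (uc i)) (s : ℝ) : 0 < partFn v u s := by
  refine (integral_pos_iff_support_of_nonneg (fun z => (canWeight_pos v u s z).le)
    (integrable_canWeight hlam hv hu s)).2 ?_
  have : Function.support (canWeight v u s) = Set.univ :=
    Set.eq_univ_of_forall fun z => (canWeight_pos v u s z).ne'
  rw [this]
  exact isOpen_univ.measure_pos _ Set.univ_nonempty

lemma exists_partFn_le (hlam : 0 < lam) (hv : PerturbedConvex lam B v vc)
    (hu : ∀ i, PerturbedConvex lam B (u i) (uc i)) : ∃ A, ∀ s, partFn v u s ≤ A := by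
  obtain ⟨A, hA⟩ := hv.exists_bound hlam
  refine ⟨∫ z, A * boltz u z, fun s => integral_mono (integrable_canWeight hlam hv hu s)
    ((integrable_boltz hlam hu).const_mul A) fun z => ?_⟩
  exact mul_le_mul_of_nonneg_right (hA _) (boltz_pos _ _).le

lemma canWeight_le_conv (hv : PerturbedConvex lam B v vc)
    (hu : ∀ i, PerturbedConvex lam B (u i) (uc i)) (s : ℝ) (z : Fin k → ℝ) :
    canWeight v u s z ≤ exp ((k + 1) * B) * canWeight vc uc s z := by
  have h1 : boltz u z ≤ exp (k * B) * boltz uc z := by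
    refine (Finset.prod_le_prod (fun _ _ => (exp_pos _).le)
      fun i _ => (hu i).exp_neg_le (z i)).trans (le_of_eq ?_)
    rw [Finset.prod_mul_distrib, Finset.prod_const, Finset.card_univ, Fintype.card_fin,
      ← exp_nat_mul]
    rfl
  calc canWeight v u s z
      ≤ (exp B * exp (-vc (s - ∑ i, z i))) * (exp (k * B) * boltz uc z) :=
        mul_le_mul (hv.exp_neg_le _) h1 (boltz_pos _ _).le (by positivity)
    _ = _ := by
      rw [canWeight, add_mul, exp_add, one_mul]
      ring

lemma canWeight_conv_le (hv : PerturbedConvex lam B v vc)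
    (hu : ∀ i, PerturbedConvex lam B (u i) (uc i)) (s : ℝ) (z : Fin k → ℝ) :
    canWeight vc uc s z ≤ exp ((k + 1) * B) * canWeight v u s z := by
  have h1 : boltz uc z ≤ exp (k * B) * boltz u z := by
    refine (Finset.prod_le_prod (fun _ _ => (exp_pos _).le)
      fun i _ => (hu i).exp_neg_conv_le (z i)).trans (le_of_eq ?_)
    rw [Finset.prod_mul_distrib, Finset.prod_const, Finset.card_univ, Fintype.card_fin,
      ← exp_nat_mul]
    rfl
  calc canWeight vc uc s z
      ≤ (exp B * exp (-v (s - ∑ i, z i))) * (exp (k * B) * boltz u z) :=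
        mul_le_mul (hv.exp_neg_conv_le _) h1 (boltz_pos _ _).le (by positivity)
    _ = _ := by
      rw [canWeight, add_mul, exp_add, one_mul]
      ring

lemma partFn_le_conv (hlam : 0 < lam) (hv : PerturbedConvex lam B v vc)
    (hu : ∀ i, PerturbedConvex lam B (u i) (uc i)) (s : ℝ) :
    partFn v u s ≤ exp ((k + 1) * B) * partFn vc uc s := by
  rw [partFn, partFn, ← integral_const_mul]
  exact integral_mono (integrable_canWeight hlam hv hu s)
    ((integrable_canWeight hlam hv.self (fun i => (hu i).self) s).const_mul _)
    fun z => canWeight_le_conv hv hu s z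

lemma partFn_conv_le (hlam : 0 < lam) (hv : PerturbedConvex lam B v vc)
    (hu : ∀ i, PerturbedConvex lam B (u i) (uc i)) (s : ℝ) :
    partFn vc uc s ≤ exp ((k + 1) * B) * partFn v u s := by
  rw [partFn, partFn, ← integral_const_mul]
  exact integral_mono (integrable_canWeight hlam hv.self (fun i => (hu i).self) s)
    ((integrable_canWeight hlam hv hu s).const_mul _)
    fun z => canWeight_conv_le hv hu s z

end Canonical

/-- Disintegration of a canonical integral along the sum of the coordinates. -/
lemma integral_canWeight_succ {k : ℕ} {v : ℝ → ℝ} {u : Fin (k + 1) → ℝ → ℝ} {s : ℝ}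
    {G : (Fin (k + 1) → ℝ) → ℝ} (hG : Integrable fun y => G y * canWeight v u s y) :
    ∫ y, G y * canWeight v u s y = ∫ t, exp (-v (s - t)) *
      ∫ z, G (sumCons t z) * canWeight (u 0) (Fin.tail u) t z := by
  have hG' := (measurePreserving_sumCons.integrable_comp_emb measurableEmbedding_sumCons).2 hG
  rw [← measurePreserving_sumCons.integral_comp measurableEmbedding_sumCons]
  refine (integral_prod _ hG').trans (integral_congr_ae (.of_forall fun t => ?_))
  simp only [Function.comp_apply, canWeight_sumCons]
  rw [← integral_const_mul]
  refine integral_congr_ae (.of_forall fun z => ?_)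
  simp only
  ring

lemma integrable_canWeight_succ {k : ℕ} {v : ℝ → ℝ} {u : Fin (k + 1) → ℝ → ℝ} {s : ℝ}
    {G : (Fin (k + 1) → ℝ) → ℝ} (hG : Integrable fun y => G y * canWeight v u s y) :
    Integrable fun t => exp (-v (s - t)) *
      ∫ z, G (sumCons t z) * canWeight (u 0) (Fin.tail u) t z := by
  have hG' := (measurePreserving_sumCons.integrable_comp_emb measurableEmbedding_sumCons).2 hG
  refine hG'.integral_prod_left.congr (.of_forall fun t => ?_)
  simp only [Function.comp_apply, canWeight_sumCons]
  rw [← integral_const_mul]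
  refine integral_congr_ae (.of_forall fun z => ?_)
  simp only
  ring

lemma integrable_deriv_canWeight {k : ℕ} {lam B : ℝ} {v vc : ℝ → ℝ}
    {u uc : Fin (k + 1) → ℝ → ℝ} (hlam : 0 < lam) (hv : PerturbedConvex lam B v vc)
    (hu : ∀ i, PerturbedConvex lam B (u i) (uc i)) (s : ℝ) :
    Integrable fun y => deriv v (s - ∑ i, y i) * canWeight v u s y := by
  rw [← measurePreserving_sumCons.integrable_comp_emb measurableEmbedding_sumCons]
  obtain ⟨A, hA⟩ := (hu 0).exists_bound hlam
  have h1 := ((hv.integrable_deriv hlam).comp_sub_left s).mul_prod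
    (integrable_boltz hlam (u := Fin.tail u) (uc := Fin.tail uc) fun i => hu i.succ)
  have h2 := h1.bdd_mul (c := A) (f := fun p : ℝ × (Fin k → ℝ) => exp (-u 0 (p.1 - ∑ i, p.2 i)))
    ((hu 0).continuous_exp.comp (by fun_prop)).aestronglyMeasurable
    (.of_forall fun p => by rw [norm_eq_abs, abs_exp]; exact hA _)
  refine h2.congr (.of_forall fun p => ?_)
  simp only [Function.comp_apply, canWeight_sumCons, sum_sumCons]
  rw [canWeight]
  ring

lemma partFn_succ {k : ℕ} {lam B : ℝ} {v vc : ℝ → ℝ} {u uc : Fin (k + 1) → ℝ → ℝ}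
    (hlam : 0 < lam) (hv : PerturbedConvex lam B v vc)
    (hu : ∀ i, PerturbedConvex lam B (u i) (uc i)) (s : ℝ) :
    partFn v u s = ∫ t, exp (-v (s - t)) * partFn (u 0) (Fin.tail u) t := by
  have := integral_canWeight_succ (G := fun _ => 1) (v := v) (u := u) (s := s)
    (by simpa using integrable_canWeight hlam hv hu s)
  simpa [partFn] using this

lemma integral_fin_zero (F : (Fin 0 → ℝ) → ℝ) : ∫ z, F z = F 0 := by
  rw [Measure.volume_pi_eq_dirac 0, integral_dirac]

lemma partFn_fin_zero (v : ℝ → ℝ) (u : Fin 0 → ℝ → ℝ) (s : ℝ) : partFn v u s = exp (-v s) := by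
  simp [partFn, integral_fin_zero, canWeight, boltz, -integral_const]

/-- The partition function of convex potentials satisfies the four-point inequality. -/
lemma fourPoint_partFn {lam B : ℝ} (hlam : 0 < lam) : ∀ (k : ℕ) {v vc : ℝ → ℝ}
    {u uc : Fin k → ℝ → ℝ}, PerturbedConvex lam B v vc →
    (∀ i, PerturbedConvex lam B (u i) (uc i)) → FourPoint (partFn vc uc) := by
  have h0 : ∀ {v vc : ℝ → ℝ}, PerturbedConvex lam B v vc → FourPoint fun s => exp (-vc s) := by
    intro v vc hv a b c d hab hac hd
    refine (hv.four_point hab hac hd).trans (mul_le_of_le_one_left (by positivity) ?_)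
    have := mul_nonneg hlam.le (mul_nonneg (sub_nonneg.2 hab) (sub_nonneg.2 hac))
    exact exp_le_one_iff.2 (by linarith)
  intro k
  induction k with
  | zero =>
    intro v vc u uc hv hu
    rw [funext (partFn_fin_zero vc uc)]
    exact h0 hv
  | succ k ih =>
    intro v vc u uc hv hu
    have hu' : ∀ i, PerturbedConvex lam B (Fin.tail u i) (Fin.tail uc i) := fun i => hu i.succ
    have hu'' : ∀ i, PerturbedConvex lam 0 (Fin.tail uc i) (Fin.tail uc i) :=
      fun i => (hu i.succ).self
    rw [funext (partFn_succ hlam hv.self fun i => (hu i).self)]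
    obtain ⟨A, hA⟩ := exists_partFn_le hlam (hu 0).self hu''
    refine (h0 hv).convolution (ih (hu 0) hu') (hv.self.integrable_exp hlam)
      (continuous_partFn hlam (hu 0).self hu'') (A := A) fun x => ?_
    rw [abs_of_pos (partFn_pos hlam (hu 0).self hu'' x)]
    exact hA x

lemma hasDerivAt_partFn {lam B : ℝ} (hlam : 0 < lam) {k : ℕ} {v vc : ℝ → ℝ}
    {u uc : Fin k → ℝ → ℝ} (hv : PerturbedConvex lam B v vc)
    (hu : ∀ i, PerturbedConvex lam B (u i) (uc i)) (s : ℝ) :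
    HasDerivAt (partFn v u) (-∫ z, deriv v (s - ∑ i, z i) * canWeight v u s z) s := by
  cases k with
  | zero =>
    rw [funext (partFn_fin_zero v u)]
    simpa [integral_fin_zero, canWeight, boltz, -integral_const] using hv.hasDerivAt_exp s
  | succ k =>
    have hu' : ∀ i, PerturbedConvex lam B (Fin.tail u i) (Fin.tail uc i) := fun i => hu i.succ
    obtain ⟨A, hA⟩ := exists_partFn_le hlam (hu 0) hu'
    have h := hasDerivAt_convolution_of_integrable hv.hasDerivAt_exp
      (hv.continuous_deriv.mul hv.continuous_exp).neg (hv.integrable_exp hlam)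
      (hv.integrable_deriv hlam).fun_neg (continuous_partFn hlam (hu 0) hu') (A := A)
      (fun x => by rw [abs_of_pos (partFn_pos hlam (hu 0) hu' x)]; exact hA x) s
    rw [funext (partFn_succ hlam hv hu)]
    convert h using 1
    rw [integral_canWeight_succ (integrable_deriv_canWeight hlam hv hu s), ← integral_neg]
    refine integral_congr_ae (.of_forall fun t => ?_)
    simp only [sum_sumCons, integral_const_mul]
    rw [partFn]
    ring

lemma hasDerivAt_sumCons {k : ℕ} (t : ℝ) (z : Fin k → ℝ) :
    HasDerivAt (fun t => sumCons t z) (Pi.single 0 1) t := by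
  refine hasDerivAt_pi.2 fun i => ?_
  refine Fin.cases ?_ (fun j => ?_) i
  · simpa using (hasDerivAt_id t).sub_const (∑ i, z i)
  · simpa using hasDerivAt_const t (z j)

/-- The linear part of the affine map `z ↦ sumCons t z`. -/
def sumConsLin (k : ℕ) : (Fin k → ℝ) →L[ℝ] (Fin (k + 1) → ℝ) :=
  ContinuousLinearMap.pi (Fin.cons (-∑ i, ContinuousLinearMap.proj i)
    fun i => ContinuousLinearMap.proj i)

lemma sumCons_eq_add {k : ℕ} (t : ℝ) (z : Fin k → ℝ) :
    sumCons t z = sumConsLin k z + sumCons t 0 := by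
  funext i
  refine Fin.cases ?_ (fun j => ?_) i
  · simp [sumConsLin]
    ring
  · simp [sumConsLin]

lemma norm_sumConsLin_le (k : ℕ) : ‖sumConsLin k‖ ≤ k + 1 := by
  refine ContinuousLinearMap.opNorm_le_bound _ (by positivity) fun z => ?_
  refine (pi_norm_le_iff_of_nonneg (by positivity)).2 fun i => ?_
  refine Fin.cases ?_ (fun j => ?_) i
  · have h1 : ‖∑ i, z i‖ ≤ k * ‖z‖ := by
      refine (norm_sum_le _ _).trans ?_
      refine (Finset.sum_le_sum fun i _ => norm_le_pi_norm z i).trans (le_of_eq ?_)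
      simp
    have h2 : sumConsLin k z 0 = -∑ i, z i := by simp [sumConsLin]
    rw [h2, norm_neg]
    nlinarith [norm_nonneg z]
  · have h2 : sumConsLin k z j.succ = z j := by simp [sumConsLin]
    rw [h2]
    have := norm_le_pi_norm z j
    have hk : (0 : ℝ) ≤ k := k.cast_nonneg
    nlinarith [norm_nonneg z]

lemma contDiff_sumCons {k : ℕ} (t : ℝ) : ContDiff ℝ 1 fun z : Fin k → ℝ => sumCons t z := by
  rw [funext (sumCons_eq_add t)]
  fun_prop

lemma norm_fderiv_comp_sumCons_le {k : ℕ} {f : (Fin (k + 1) → ℝ) → ℝ} (hf : ContDiff ℝ 1 f)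
    (t : ℝ) (z : Fin k → ℝ) :
    ‖fderiv ℝ (fun z => f (sumCons t z)) z‖ ≤ (k + 1) * ‖fderiv ℝ f (sumCons t z)‖ := by
  have h1 : HasFDerivAt (fun z : Fin k → ℝ => sumCons t z) (sumConsLin k) z := by
    rw [funext (sumCons_eq_add t)]
    exact (sumConsLin k).hasFDerivAt.add_const _
  have h2 := (hf.differentiable one_ne_zero (sumCons t z)).hasFDerivAt.comp z h1
  have h3 : fderiv ℝ (fun z => f (sumCons t z)) z =
      (fderiv ℝ f (sumCons t z)).comp (sumConsLin k) := h2.fderiv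
  rw [h3, mul_comm]
  refine (ContinuousLinearMap.opNorm_comp_le _ _).trans ?_
  gcongr
  exact norm_sumConsLin_le k

lemma HasCompactSupport.comp_sumCons {k : ℕ} {f : (Fin (k + 1) → ℝ) → ℝ}
    (hf : HasCompactSupport f) (t : ℝ) : HasCompactSupport fun z => f (sumCons t z) := by
  have hc : Continuous (Fin.tail : (Fin (k + 1) → ℝ) → (Fin k → ℝ)) :=
    continuous_pi fun i => continuous_apply i.succ
  refine HasCompactSupport.intro (hf.isCompact.image hc) fun z hz => ?_
  by_contra hne
  exact hz ⟨sumCons t z, subset_tsupport _ hne, rfl⟩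

lemma abs_sub_le_integral_of_abs_deriv_le {J J' K : ℝ → ℝ} (hJ : ∀ x, HasDerivAt J (J' x) x)
    (hK : Continuous K) (h : ∀ x, |J' x| ≤ K x) {a b : ℝ} (hab : a ≤ b) :
    |J b - J a| ≤ ∫ x in a..b, K x := by
  have hB : ∀ x, HasDerivAt (fun x => ∫ r in a..x, K r) (K x) x := fun x =>
    intervalIntegral.integral_hasDerivAt_right (hK.intervalIntegrable _ _)
      hK.aestronglyMeasurable.stronglyMeasurableAtFilter hK.continuousAt
  exact image_norm_le_of_norm_deriv_right_le_deriv_boundary (f := fun x => J x - J a)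
    (f' := J') (B := fun x => ∫ r in a..x, K r) (B' := K)
    (fun x _ => ((hJ x).continuousAt.sub continuousAt_const).continuousWithinAt)
    (fun x _ => ((hJ x).sub_const _).hasDerivWithinAt) (by simp)
    (fun x => hB x) (fun x _ => h x) (Set.right_mem_Icc.2 hab)

section CanonicalIntegral

variable {k : ℕ} {lam B : ℝ} {v vc : ℝ → ℝ} {u uc : Fin k → ℝ → ℝ}

lemma integrable_mul_canWeight (hlam : 0 < lam) (hv : PerturbedConvex lam B v vc)
    (hu : ∀ i, PerturbedConvex lam B (u i) (uc i)) {G : (Fin k → ℝ) → ℝ} (hG : Continuous G)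
    (hGs : HasCompactSupport G) (s : ℝ) : Integrable fun z => G z * canWeight v u s z := by
  obtain ⟨A, hA⟩ := hGs.exists_bound_of_continuous hG
  exact (integrable_canWeight hlam hv hu s).bdd_mul (c := A) hG.aestronglyMeasurable
    (.of_forall hA)

lemma continuous_integral_canWeight (hlam : 0 < lam) (hv : PerturbedConvex lam B v vc)
    (hu : ∀ i, PerturbedConvex lam B (u i) (uc i)) {G : (Fin (k + 1) → ℝ) → ℝ}
    (hG : Continuous G) (hGs : HasCompactSupport G) :
    Continuous fun t => ∫ z, G (sumCons t z) * canWeight v u t z := by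
  have hc : Continuous fun y : Fin (k + 1) → ℝ => G y * exp (-v (y 0)) :=
    hG.mul (hv.continuous_exp.comp (continuous_apply 0))
  obtain ⟨A, hA⟩ := (hGs.mul_right (f' := fun y => exp (-v (y 0)))).exists_bound_of_continuous hc
  have := continuous_integral_sumCons hlam hu hc hA
  simpa only [canWeight, sumCons_zero, mul_assoc] using this

lemma hasDerivAt_integral_canWeight (hlam : 0 < lam) (hv : PerturbedConvex lam B v vc)
    (hu : ∀ i, PerturbedConvex lam B (u i) (uc i)) {f : (Fin (k + 1) → ℝ) → ℝ}
    (hf : ContDiff ℝ 1 f) (hfs : HasCompactSupport f) (t : ℝ) :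
    HasDerivAt (fun t => ∫ z, f (sumCons t z) * canWeight v u t z)
      ((∫ z, fderiv ℝ f (sumCons t z) (Pi.single 0 1) * canWeight v u t z) -
        ∫ z, f (sumCons t z) * (deriv v (t - ∑ i, z i) * canWeight v u t z)) t := by
  have hD : Continuous fun y => fderiv ℝ f y (Pi.single 0 1) :=
    (hf.continuous_fderiv one_ne_zero).clm_apply continuous_const
  have hDs : HasCompactSupport fun y => fderiv ℝ f y (Pi.single 0 1) :=
    (hfs.fderiv (𝕜 := ℝ)).comp_left (g := fun L : (Fin (k + 1) → ℝ) →L[ℝ] ℝ =>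
      L (Pi.single 0 1)) rfl
  have he : Continuous fun y : Fin (k + 1) → ℝ => exp (-v (y 0)) :=
    hv.continuous_exp.comp (continuous_apply 0)
  have hv' : Continuous fun y : Fin (k + 1) → ℝ => deriv v (y 0) :=
    hv.continuous_deriv.comp (continuous_apply 0)
  have bd : ∀ {G : (Fin (k + 1) → ℝ) → ℝ}, Continuous G → HasCompactSupport G →
      ∃ A, ∀ y, |G y * exp (-v (y 0))| ≤ A := fun hG hGs =>
    (hGs.mul_right (f' := fun y => exp (-v (y 0)))).exists_bound_of_continuous (hG.mul he)
  obtain ⟨A, hA⟩ := bd hf.continuous hfs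
  have hFv : Continuous fun y : Fin (k + 1) → ℝ => f y * deriv v (y 0) := hf.continuous.mul hv'
  have hFvs : HasCompactSupport fun y : Fin (k + 1) → ℝ => f y * deriv v (y 0) := hfs.mul_right
  obtain ⟨A₁, hA₁⟩ := bd hD hDs
  obtain ⟨A₂, hA₂⟩ := bd hFv hFvs
  obtain ⟨A₃, hA₃⟩ := bd (hD.sub hFv) (hDs.sub hFvs)
  have key := hasDerivAt_integral_sumCons hlam hu (hf.continuous.mul he) hA
    ((hD.sub hFv).mul he) hA₃ (fun t z => by
      have h1 := (hf.differentiable one_ne_zero (sumCons t z)).hasFDerivAt.comp_hasDerivAt t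
        (hasDerivAt_sumCons t z)
      have h2 : HasDerivAt (fun t => exp (-v (sumCons t z 0)))
          (-(deriv v (t - ∑ i, z i) * exp (-v (t - ∑ i, z i)))) t := by
        simpa using (hv.hasDerivAt_exp (t - ∑ i, z i)).comp_sub_const t (∑ i, z i)
      refine (h1.mul h2).congr_deriv ?_
      simp only [sumCons_zero, Function.comp_apply, Pi.mul_apply, Pi.sub_apply]
      ring) t
  have e : (∫ z, (fderiv ℝ f (sumCons t z) (Pi.single 0 1) -
      f (sumCons t z) * deriv v (sumCons t z 0)) * exp (-v (sumCons t z 0)) * boltz u z) =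
      (∫ z, fderiv ℝ f (sumCons t z) (Pi.single 0 1) * canWeight v u t z) -
        ∫ z, f (sumCons t z) * (deriv v (t - ∑ i, z i) * canWeight v u t z) := by
    have i1 := integrable_sumCons_mul_boltz hlam hu (hD.mul he) hA₁ t
    have i2 := integrable_sumCons_mul_boltz hlam hu (hFv.mul he) hA₂ t
    have := integral_sub i1 i2
    simp only [canWeight, sumCons_zero, Pi.mul_apply] at this ⊢
    refine Eq.trans (integral_congr_ae (.of_forall fun z => ?_)) (this.trans ?_)
    · simp only
      ring
    · congr 1 <;> refine integral_congr_ae (.of_forall fun z => ?_) <;> simp only <;> ring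
  rw [← e]
  simpa only [canWeight, sumCons_zero, Pi.mul_apply, Pi.sub_apply, mul_assoc] using key

end CanonicalIntegral

lemma hasCompactSupport_norm_fderiv {n : ℕ} {f : (Fin n → ℝ) → ℝ} (hf : HasCompactSupport f) :
    HasCompactSupport fun y => ‖fderiv ℝ f y‖ :=
  (hf.fderiv (𝕜 := ℝ)).norm

/-- Along the sum of the coordinates, the conditional mean of `f` varies at a rate controlled by
the conditional mean of `‖Df‖`, provided the conditional measures satisfy a covariance bound. -/
lemma condMean_hasDerivAt {k : ℕ} {lam B c : ℝ} {v vc : ℝ → ℝ} {u uc : Fin k → ℝ → ℝ}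
    (hlam : 0 < lam) (hc : 0 ≤ c) (hv : PerturbedConvex lam B v vc)
    (hu : ∀ i, PerturbedConvex lam B (u i) (uc i)) {f : (Fin (k + 1) → ℝ) → ℝ}
    (hf : ContDiff ℝ 1 f) (hfs : HasCompactSupport f) (t : ℝ)
    (hcov : |partFn v u t * (∫ z, f (sumCons t z) *
          (deriv v (t - ∑ i, z i) * canWeight v u t z)) -
        (∫ z, f (sumCons t z) * canWeight v u t z) *
          ∫ z, deriv v (t - ∑ i, z i) * canWeight v u t z| ≤
      c * (partFn v u t * ∫ z, ‖fderiv ℝ (fun z => f (sumCons t z)) z‖ * canWeight v u t z)) :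
    ∃ J', HasDerivAt (fun t => (∫ z, f (sumCons t z) * canWeight v u t z) / partFn v u t) J' t ∧
      |J'| ≤ (1 + c * (k + 1)) *
        ((∫ z, ‖fderiv ℝ f (sumCons t z)‖ * canWeight v u t z) / partFn v u t) := by
  have hZ := partFn_pos hlam hv hu t
  refine ⟨_, (hasDerivAt_integral_canWeight hlam hv hu hf hfs t).div
    (hasDerivAt_partFn hlam hv hu t) hZ.ne', ?_⟩
  have hDc : Continuous fun y => ‖fderiv ℝ f y‖ := (hf.continuous_fderiv one_ne_zero).norm
  have hDs : HasCompactSupport fun y => ‖fderiv ℝ f y‖ := hasCompactSupport_norm_fderiv hfs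
  have hsc := (contDiff_sumCons (k := k) t).continuous
  have iD : Integrable fun z => ‖fderiv ℝ f (sumCons t z)‖ * canWeight v u t z :=
    integrable_mul_canWeight hlam hv hu (hDc.comp hsc) (by
      obtain ⟨A, hA⟩ := hDs.exists_bound_of_continuous hDc
      have hct : Continuous (Fin.tail : (Fin (k + 1) → ℝ) → (Fin k → ℝ)) :=
        continuous_pi fun i => continuous_apply i.succ
      refine HasCompactSupport.intro (hDs.isCompact.image hct) fun z hz => ?_
      by_contra hne
      exact hz ⟨sumCons t z, subset_tsupport _ hne, rfl⟩) t
  have hft : ContDiff ℝ 1 fun z => f (sumCons t z) := hf.comp (contDiff_sumCons (k := k) t)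
  have hfts := hfs.comp_sumCons t
  have h1 : |∫ z, fderiv ℝ f (sumCons t z) (Pi.single 0 1) * canWeight v u t z| ≤
      ∫ z, ‖fderiv ℝ f (sumCons t z)‖ * canWeight v u t z := by
    rw [← norm_eq_abs]
    refine norm_integral_le_of_norm_le iD (.of_forall fun z => ?_)
    rw [norm_mul, norm_of_nonneg (canWeight_pos v u t z).le]
    refine mul_le_mul_of_nonneg_right ?_ (canWeight_pos v u t z).le
    refine (ContinuousLinearMap.le_opNorm _ _).trans (mul_le_of_le_one_right (norm_nonneg _) ?_)
    refine (pi_norm_le_iff_of_nonneg zero_le_one).2 fun i => ?_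
    refine Fin.cases ?_ (fun j => ?_) i <;> simp
  have h2 : ∫ z, ‖fderiv ℝ (fun z => f (sumCons t z)) z‖ * canWeight v u t z ≤
      (k + 1) * ∫ z, ‖fderiv ℝ f (sumCons t z)‖ * canWeight v u t z := by
    rw [← integral_const_mul]
    refine integral_mono (integrable_mul_canWeight hlam hv hu
      (hft.continuous_fderiv one_ne_zero).norm (hasCompactSupport_norm_fderiv hfts) t)
      (iD.const_mul _) fun z => ?_
    simp only
    rw [← mul_assoc]
    exact mul_le_mul_of_nonneg_right (norm_fderiv_comp_sumCons_le hf t z)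
      (canWeight_pos v u t z).le
  rw [abs_div, abs_of_pos (pow_pos hZ 2), div_le_iff₀ (pow_pos hZ 2)]
  set Z := partFn v u t
  set D := ∫ z, ‖fderiv ℝ f (sumCons t z)‖ * canWeight v u t z
  set D' := ∫ z, ‖fderiv ℝ (fun z => f (sumCons t z)) z‖ * canWeight v u t z
  set I := ∫ z, f (sumCons t z) * canWeight v u t z
  set P := ∫ z, fderiv ℝ f (sumCons t z) (Pi.single 0 1) * canWeight v u t z
  set Q := ∫ z, f (sumCons t z) * (deriv v (t - ∑ i, z i) * canWeight v u t z)
  set R := ∫ z, deriv v (t - ∑ i, z i) * canWeight v u t z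
  calc |(P - Q) * Z - I * -R| = |P * Z - (Z * Q - I * R)| := by ring_nf
    _ ≤ |P * Z| + |Z * Q - I * R| := abs_sub _ _
    _ ≤ D * Z + c * (Z * ((k + 1) * D)) := by
        rw [abs_mul, abs_of_pos hZ]
        gcongr
        refine hcov.trans ?_
        gcongr
    _ = _ := by
        field_simp

/-- Covariance bound for canonical weights, the slack coordinate carrying the potential `v`. -/
theorem exists_canWeight_cov_le {lam B : ℝ} (hlam : 0 < lam) (hB : 0 ≤ B) (k : ℕ) :
    ∃ C, 0 ≤ C ∧ ∀ {v vc : ℝ → ℝ} {u uc : Fin k → ℝ → ℝ}, PerturbedConvex lam B v vc →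
      (∀ i, PerturbedConvex lam B (u i) (uc i)) → ∀ (s : ℝ) (f : (Fin k → ℝ) → ℝ),
      ContDiff ℝ 1 f → HasCompactSupport f →
      |partFn v u s * (∫ z, f z * (deriv v (s - ∑ i, z i) * canWeight v u s z)) -
          (∫ z, f z * canWeight v u s z) *
            ∫ z, deriv v (s - ∑ i, z i) * canWeight v u s z| ≤
        C * (partFn v u s * ∫ z, ‖fderiv ℝ f z‖ * canWeight v u s z) := by
  induction k with
  | zero =>
    refine ⟨0, le_rfl, fun {v vc u uc} _ _ s f _ _ => ?_⟩
    simp only [integral_fin_zero, partFn]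
    rw [zero_mul, abs_nonpos_iff]
    ring
  | succ k ih =>
    obtain ⟨c, hc, ih⟩ := ih
    refine ⟨PerturbedConvex.covConst lam B ((k + 1) * B) * (1 + c * (k + 1)),
      by unfold PerturbedConvex.covConst; positivity, fun {v vc u uc} hv hu s f hf hfs => ?_⟩
    have hu' : ∀ i, PerturbedConvex lam B (Fin.tail u i) (Fin.tail uc i) := fun i => hu i.succ
    have hu0 := hu 0
    set Z := partFn (u 0) (Fin.tail u) with hZdef
    set I : ℝ → ℝ := fun t => ∫ z, f (sumCons t z) * canWeight (u 0) (Fin.tail u) t z with hI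
    set D : ℝ → ℝ := fun t => ∫ z, ‖fderiv ℝ f (sumCons t z)‖ *
      canWeight (u 0) (Fin.tail u) t z with hD
    have hZ : ∀ t, 0 < Z t := partFn_pos hlam hu0 hu'
    have hZc : Continuous Z := continuous_partFn hlam hu0 hu'
    obtain ⟨A, hA⟩ := exists_partFn_le hlam hu0 hu'
    have hDfc : Continuous fun y => ‖fderiv ℝ f y‖ := (hf.continuous_fderiv one_ne_zero).norm
    have hDfs : HasCompactSupport fun y => ‖fderiv ℝ f y‖ := hasCompactSupport_norm_fderiv hfs
    have hD0 : ∀ t, 0 ≤ D t := fun t =>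
      integral_nonneg fun z => mul_nonneg (norm_nonneg _) (canWeight_pos _ _ _ _).le
    have hDc : Continuous D := continuous_integral_canWeight hlam hu0 hu' hDfc hDfs
    have hIc : Continuous I := continuous_integral_canWeight hlam hu0 hu' hf.continuous hfs
    choose J' hJ' hJK using fun t => condMean_hasDerivAt hlam hc hu0 hu' hf hfs t
      (ih hu0 hu' t _ (hf.comp (contDiff_sumCons (k := k) t)) (hfs.comp_sumCons t))
    obtain ⟨A', hA'⟩ := hfs.exists_bound_of_continuous hf.continuous
    have hIA : ∀ t, |I t| ≤ A' * Z t := fun t => by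
      rw [hZdef, partFn, ← integral_const_mul]
      rw [← norm_eq_abs]
      refine norm_integral_le_of_norm_le ((integrable_canWeight hlam hu0 hu' t).const_mul _)
        (.of_forall fun z => ?_)
      rw [norm_mul, norm_of_nonneg (canWeight_pos _ _ _ _).le]
      exact mul_le_mul_of_nonneg_right (hA' _) (canWeight_pos _ _ _ _).le
    have iD := integrable_canWeight_succ (integrable_mul_canWeight hlam hv hu hDfc hDfs s)
    have key := (hv.comp_sub s).abs_covariance_le hlam (b := (k + 1) * B) (A := A) (A' := A')
      (q := Z) (qc := partFn (uc 0) (Fin.tail uc)) (F := fun t => I t / Z t)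
      (K := fun t => (1 + c * (k + 1)) * (D t / Z t))
      (fourPoint_partFn hlam k hu0 hu') (fun x => (hZ x).le)
      (fun x => (partFn_pos hlam hu0.self (fun i => (hu' i).self) x).le)
      hZc (continuous_partFn hlam hu0.self fun i => (hu' i).self) hA
      (partFn_le_conv hlam hu0 hu') (partFn_conv_le hlam hu0 hu')
      (hIc.div hZc fun x => (hZ x).ne') (fun x => by
        rw [abs_div, abs_of_pos (hZ x), div_le_iff₀ (hZ x)]
        exact hIA x)
      (continuous_const.mul (hDc.div hZc fun x => (hZ x).ne'))
      (fun x => by have := hD0 x; have := hZ x; positivity)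
      (fun a b hab => abs_sub_le_integral_of_abs_deriv_le hJ'
        (continuous_const.mul (hDc.div hZc fun x => (hZ x).ne')) hJK hab)
      ((iD.const_mul (1 + c * (k + 1))).congr (.of_forall fun t => by
        have := (hZ t).ne'
        simp only [hD]
        field_simp))
    have e0 : (∫ x, exp (-v (s - x)) * Z x) = partFn v u s := (partFn_succ hlam hv hu s).symm
    have e1 : (∫ x, I x / Z x * (exp (-v (s - x)) * Z x)) = ∫ y, f y * canWeight v u s y := by
      rw [integral_canWeight_succ (integrable_mul_canWeight hlam hv hu hf.continuous hfs s)]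
      refine integral_congr_ae (.of_forall fun t => ?_)
      have := (hZ t).ne'
      simp only [hI]
      field_simp
    have e2 : (∫ x, (1 + c * (k + 1)) * (D x / Z x) * (exp (-v (s - x)) * Z x)) =
        (1 + c * (k + 1)) * ∫ y, ‖fderiv ℝ f y‖ * canWeight v u s y := by
      rw [integral_canWeight_succ (integrable_mul_canWeight hlam hv hu hDfc hDfs s),
        ← integral_const_mul]
      refine integral_congr_ae (.of_forall fun t => ?_)
      have := (hZ t).ne'
      simp only [hD]
      field_simp
    have hd : ∀ x, deriv (fun x => v (s - x)) x = -deriv v (s - x) := fun x =>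
      deriv_comp_const_sub v s x
    have iv := integrable_deriv_canWeight hlam hv hu s
    have e3 : (∫ x, -deriv v (s - x) * (exp (-v (s - x)) * Z x)) =
        -∫ y, deriv v (s - ∑ i, y i) * canWeight v u s y := by
      rw [integral_canWeight_succ iv, ← integral_neg]
      refine integral_congr_ae (.of_forall fun t => ?_)
      simp only [sum_sumCons, integral_const_mul, hZdef, partFn]
      ring
    have ifv : Integrable fun y => (f y * deriv v (s - ∑ i, y i)) * canWeight v u s y := by
      simpa only [mul_assoc] using
        iv.bdd_mul (c := A') hf.continuous.aestronglyMeasurable (.of_forall hA')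
    have e4 : (∫ x, I x / Z x * -deriv v (s - x) * (exp (-v (s - x)) * Z x)) =
        -∫ y, f y * (deriv v (s - ∑ i, y i) * canWeight v u s y) := by
      simp only [← mul_assoc]
      rw [integral_canWeight_succ ifv, ← integral_neg]
      refine integral_congr_ae (.of_forall fun t => ?_)
      have hz := (hZ t).ne'
      have : (∫ z, f (sumCons t z) * deriv v (s - t) * canWeight (u 0) (Fin.tail u) t z) =
          deriv v (s - t) * I t := by
        rw [hI, ← integral_const_mul]
        refine integral_congr_ae (.of_forall fun z => ?_)
        simp only
        ring
      simp only [sum_sumCons, this]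
      field_simp
    simp only [hd] at key
    rw [e0, e1, e2, e3, e4] at key
    rw [← abs_neg]
    refine le_trans (le_of_eq ?_) (key.trans (le_of_eq ?_))
    · congr 1
      ring
    · ring

/-- The point of the hyperplane `∑ xⱼ = s` with coordinates `y` away from the slot `i`. -/
def slackPt {n : ℕ} (i : Fin (n + 1)) (s : ℝ) (y : Fin n → ℝ) : EuclideanSpace ℝ (Fin (n + 1)) :=
  WithLp.toLp 2 (i.insertNth (α := fun _ => ℝ) (s - ∑ j, y j) y)

@[simp] lemma slackPt_same {n : ℕ} (i : Fin (n + 1)) (s : ℝ) (y : Fin n → ℝ) :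
    slackPt i s y i = s - ∑ j, y j := by simp [slackPt]

@[simp] lemma slackPt_succAbove {n : ℕ} (i : Fin (n + 1)) (s : ℝ) (y : Fin n → ℝ) (j : Fin n) :
    slackPt i s y (i.succAbove j) = y j := by simp [slackPt]

lemma sum_slackPt {n : ℕ} (i : Fin (n + 1)) (s : ℝ) (y : Fin n → ℝ) :
    ∑ j, slackPt i s y j = s := by
  rw [Fin.sum_univ_succAbove _ i]
  simp

/-- The linear part of `slackPt`, as a linear map. -/
def slackLin {n : ℕ} (i : Fin (n + 1)) : (Fin n → ℝ) →ₗ[ℝ] EuclideanSpace ℝ (Fin (n + 1)) where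
  toFun := slackPt i 0
  map_add' y z := by
    ext j
    revert j
    rw [Fin.forall_iff_succAbove i]
    refine ⟨?_, fun j => by simp⟩
    simp [Finset.sum_add_distrib]
    ring
  map_smul' c y := by
    ext j
    revert j
    rw [Fin.forall_iff_succAbove i]
    refine ⟨?_, fun j => by simp⟩
    simp [Finset.mul_sum]

lemma slackPt_eq_add {n : ℕ} (i : Fin (n + 1)) (s : ℝ) (y : Fin n → ℝ) :
    slackPt i s y = slackLin i y + slackPt i s 0 := by
  ext j
  revert j
  rw [Fin.forall_iff_succAbove i]
  refine ⟨?_, fun j => by simp [slackLin]⟩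
  simp [slackLin]
  ring

lemma slackLin_injective {n : ℕ} (i : Fin (n + 1)) : Function.Injective (slackLin i) := by
  intro y z h
  funext j
  have h' : slackPt i 0 y = slackPt i 0 z := h
  rw [← slackPt_succAbove i 0 y j, h', slackPt_succAbove]

lemma continuous_slackPt {n : ℕ} (i : Fin (n + 1)) (s : ℝ) : Continuous (slackPt i s) := by
  rw [funext (slackPt_eq_add i s)]
  exact (slackLin i).continuous_of_finiteDimensional.add continuous_const

lemma measurableEmbedding_slackPt {n : ℕ} (i : Fin (n + 1)) (s : ℝ) :
    MeasurableEmbedding (slackPt i s) := by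
  refine (continuous_slackPt i s).measurableEmbedding fun y z h => ?_
  rw [slackPt_eq_add, slackPt_eq_add i s z] at h
  exact slackLin_injective i (add_right_cancel h)

lemma range_slackPt {n : ℕ} (i : Fin (n + 1)) (s : ℝ) :
    Set.range (slackPt i s) = {x | ∑ j, x j = s} := by
  ext x
  refine ⟨?_, fun hx => ⟨fun j => x (i.succAbove j), ?_⟩⟩
  · rintro ⟨y, rfl⟩
    exact sum_slackPt i s y
  · have hx' : x i + ∑ j, x (i.succAbove j) = s := by
      rw [← Fin.sum_univ_succAbove (fun j => x j) i]
      exact hx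
    ext j
    revert j
    rw [Fin.forall_iff_succAbove i]
    refine ⟨?_, fun j => by simp⟩
    simp only [slackPt_same]
    linarith

/-- Hausdorff measure on the hyperplane `∑ xⱼ = s` is a multiple of Lebesgue measure in the
coordinates complementary to the slot `i`. -/
lemma hausdorffMeasure_hyperplane {n : ℕ} (i : Fin (n + 1)) (s : ℝ) :
    ∃ c : ℝ≥0∞, c ≠ 0 ∧ c ≠ ∞ ∧
      (μH[((n + 1 : ℕ) : ℝ) - 1]).restrict
        {x : EuclideanSpace ℝ (Fin (n + 1)) | ∑ j, x j = s} =
      c • Measure.map (slackPt i s) volume := by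
  let V := LinearMap.range (slackLin i)
  let e : (Fin n → ℝ) ≃L[ℝ] V :=
    (LinearEquiv.ofInjective (slackLin i) (slackLin_injective i)).toContinuousLinearEquiv
  have hfin : Module.finrank ℝ V = n := by
    rw [LinearMap.finrank_range_of_inj (slackLin_injective i)]
    simp
  have h1 : (Measure.map e volume).IsAddHaarMeasure := e.isAddHaarMeasure_map volume
  have h2 : (μH[(Module.finrank ℝ V : ℝ)] : Measure V).IsAddHaarMeasure :=
    isAddHaarMeasure_hausdorffMeasure
  have h3 := Measure.isAddLeftInvariant_eq_smul (μH[(Module.finrank ℝ V : ℝ)] : Measure V)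
    (Measure.map e volume)
  have hpos := Measure.addHaarScalarFactor_pos_of_isAddHaarMeasure
    (μH[(Module.finrank ℝ V : ℝ)] : Measure V) (Measure.map e volume)
  set r := Measure.addHaarScalarFactor (μH[(Module.finrank ℝ V : ℝ)] : Measure V)
    (Measure.map e volume)
  let g : V → EuclideanSpace ℝ (Fin (n + 1)) := fun x => x + slackPt i s 0
  have hg : Isometry g := (isometry_add_right (slackPt i s 0)).comp isometry_subtype_coe
  have hge : g ∘ e = slackPt i s := by
    funext y
    exact (slackPt_eq_add i s y).symm
  have hrange : Set.range g = {x | ∑ j, x j = s} := by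
    rw [← range_slackPt i s, ← hge, Set.range_comp, e.surjective.range_eq, Set.image_univ]
  refine ⟨r, by exact_mod_cast hpos.ne', ENNReal.coe_ne_top, ?_⟩
  have hd : ((n + 1 : ℕ) : ℝ) - 1 = (Module.finrank ℝ V : ℝ) := by
    rw [hfin]
    push_cast
    ring
  rw [hd, ← hrange, ← hg.map_hausdorffMeasure (Or.inl (Nat.cast_nonneg _)), h3, Measure.map_smul,
    Measure.map_map hg.continuous.measurable e.continuous.measurable, hge]
  rfl

section Ensemble

variable {n : ℕ} {ψ : ℝ → ℝ} {lam B : ℝ}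

/-- The one-site potential at site `i`. -/
def sitePot (ψ : ℝ → ℝ) {n : ℕ} (a : Fin n → ℝ) (i : Fin n) (x : ℝ) : ℝ := ψ x + a i * x

lemma exp_sitePot_slackPt (a : Fin (n + 1) → ℝ) (i : Fin (n + 1)) (s : ℝ) (y : Fin n → ℝ) :
    exp (-(∑ j, (ψ (slackPt i s y j) + a j * slackPt i s y j))) =
      canWeight (sitePot ψ a i) (fun j => sitePot ψ a (i.succAbove j)) s y := by
  rw [Fin.sum_univ_succAbove _ i, neg_add, exp_add, ← Finset.sum_neg_distrib, exp_sum]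
  simp [canWeight, boltz, sitePot]

variable {a : Fin (n + 1) → ℝ} {w : Fin (n + 1) → ℝ → ℝ}

lemma canonEns_eq_smul_map (hψ : Continuous ψ) (hlam : 0 < lam)
    (hp : ∀ i, PerturbedConvex lam B (sitePot ψ a i) (w i)) (i : Fin (n + 1)) (m : ℝ) :
    canonEns ψ (n + 1) a m =
      (ENNReal.ofReal (partFn (sitePot ψ a i) (fun j => sitePot ψ a (i.succAbove j))
        (((n + 1 : ℕ) : ℝ) * m)))⁻¹ •
      Measure.map (slackPt i (((n + 1 : ℕ) : ℝ) * m)) (volume.withDensity fun y => ENNReal.ofReal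
        (canWeight (sitePot ψ a i) (fun j => sitePot ψ a (i.succAbove j))
          (((n + 1 : ℕ) : ℝ) * m) y)) := by
  set s := ((n + 1 : ℕ) : ℝ) * m with hs
  obtain ⟨c, hc0, hct, hc⟩ := hausdorffMeasure_hyperplane i s
  have hem := measurableEmbedding_slackPt i s
  have hmeas : Measurable fun x : EuclideanSpace ℝ (Fin (n + 1)) =>
      ENNReal.ofReal (Real.exp (-(∑ i, (ψ (x i) + a i * x i)))) := by
    refine (Continuous.measurable ?_).ennreal_ofReal
    fun_prop
  have hwd : (Measure.map (slackPt i s) volume).withDensity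
      (fun x : EuclideanSpace ℝ (Fin (n + 1)) =>
        ENNReal.ofReal (Real.exp (-(∑ i, (ψ (x i) + a i * x i))))) =
      Measure.map (slackPt i s) (volume.withDensity fun y => ENNReal.ofReal
        (canWeight (sitePot ψ a i) (fun j => sitePot ψ a (i.succAbove j)) s y)) := by
    ext A hA
    rw [withDensity_apply _ hA, Measure.map_apply hem.measurable hA,
      withDensity_apply _ (hem.measurable hA), hem.restrict_map, hem.lintegral_map]
    simp_rw [exp_sitePot_slackPt]
  have hmass : (volume.withDensity fun y => ENNReal.ofReal
      (canWeight (sitePot ψ a i) (fun j => sitePot ψ a (i.succAbove j)) s y)) Set.univ =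
      ENNReal.ofReal (partFn (sitePot ψ a i) (fun j => sitePot ψ a (i.succAbove j)) s) := by
    rw [withDensity_apply _ MeasurableSet.univ, Measure.restrict_univ, partFn,
      ofReal_integral_eq_lintegral_ofReal (integrable_canWeight hlam (hp i) (fun j => hp _) s)
        (Filter.Eventually.of_forall fun y => (canWeight_pos _ _ _ _).le)]
  rw [canonEns]
  simp only [← hs]
  rw [hc, withDensity_smul_measure, hwd, Measure.smul_apply, Measure.map_apply hem.measurable
    MeasurableSet.univ, Set.preimage_univ, hmass, smul_smul, smul_eq_mul,
    ENNReal.mul_inv (Or.inl hc0) (Or.inl hct), mul_right_comm, ENNReal.inv_mul_cancel hc0 hct,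
    one_mul]

lemma integrable_canonEns_iff (hψ : Continuous ψ) (hlam : 0 < lam)
    (hp : ∀ i, PerturbedConvex lam B (sitePot ψ a i) (w i)) (i : Fin (n + 1)) (m : ℝ)
    {F : EuclideanSpace ℝ (Fin (n + 1)) → ℝ} :
    Integrable F (canonEns ψ (n + 1) a m) ↔
      Integrable fun y => F (slackPt i (((n + 1 : ℕ) : ℝ) * m) y) *
        canWeight (sitePot ψ a i) (fun j => sitePot ψ a (i.succAbove j))
          (((n + 1 : ℕ) : ℝ) * m) y := by
  have hZ := partFn_pos hlam (hp i) (fun j => hp (i.succAbove j)) (((n + 1 : ℕ) : ℝ) * m)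
  have hcont : Continuous (canWeight (sitePot ψ a i) (fun j => sitePot ψ a (i.succAbove j))
      (((n + 1 : ℕ) : ℝ) * m)) := (continuous_canWeight (hp i) fun j => hp (i.succAbove j)).comp
    (Continuous.prodMk_right (((n + 1 : ℕ) : ℝ) * m))
  rw [canonEns_eq_smul_map hψ hlam hp i m, integrable_smul_measure (by simp) (by simpa using hZ),
    (measurableEmbedding_slackPt i _).integrable_map_iff,
    integrable_withDensity_iff_integrable_smul' (hcont.measurable.ennreal_ofReal) (by simp)]
  refine integrable_congr (Filter.Eventually.of_forall fun y => ?_)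
  simp only [Function.comp_apply, smul_eq_mul]
  rw [ENNReal.toReal_ofReal (canWeight_pos _ _ _ _).le, mul_comm]

lemma integral_canonEns (hψ : Continuous ψ) (hlam : 0 < lam)
    (hp : ∀ i, PerturbedConvex lam B (sitePot ψ a i) (w i)) (i : Fin (n + 1)) (m : ℝ)
    (F : EuclideanSpace ℝ (Fin (n + 1)) → ℝ) :
    ∫ x, F x ∂(canonEns ψ (n + 1) a m) =
      (partFn (sitePot ψ a i) (fun j => sitePot ψ a (i.succAbove j)) (((n + 1 : ℕ) : ℝ) * m))⁻¹ *
      ∫ y, F (slackPt i (((n + 1 : ℕ) : ℝ) * m) y) *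
        canWeight (sitePot ψ a i) (fun j => sitePot ψ a (i.succAbove j))
          (((n + 1 : ℕ) : ℝ) * m) y := by
  have hZ := partFn_pos hlam (hp i) (fun j => hp (i.succAbove j)) (((n + 1 : ℕ) : ℝ) * m)
  have hcont : Continuous (canWeight (sitePot ψ a i) (fun j => sitePot ψ a (i.succAbove j))
      (((n + 1 : ℕ) : ℝ) * m)) := (continuous_canWeight (hp i) fun j => hp (i.succAbove j)).comp
    (Continuous.prodMk_right (((n + 1 : ℕ) : ℝ) * m))
  rw [canonEns_eq_smul_map hψ hlam hp i m, integral_smul_measure,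
    (measurableEmbedding_slackPt i _).integral_map,
    integral_withDensity_eq_integral_toReal_smul (hcont.measurable.ennreal_ofReal) (by simp),
    ENNReal.toReal_inv, ENNReal.toReal_ofReal hZ.le, smul_eq_mul]
  congr 1
  refine integral_congr_ae (Filter.Eventually.of_forall fun y => ?_)
  simp only [smul_eq_mul]
  rw [ENNReal.toReal_ofReal (canWeight_pos _ _ _ _).le, mul_comm]

lemma isProbabilityMeasure_canonEns (hψ : Continuous ψ) (hlam : 0 < lam)
    (hp : ∀ i, PerturbedConvex lam B (sitePot ψ a i) (w i)) (m : ℝ) :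
    IsProbabilityMeasure (canonEns ψ (n + 1) a m) := by
  have hp0 := fun j : Fin n => hp ((0 : Fin (n + 1)).succAbove j)
  have hZ := partFn_pos hlam (hp 0) hp0 (((n + 1 : ℕ) : ℝ) * m)
  have h : ∫ x, (1 : ℝ) ∂(canonEns ψ (n + 1) a m) = 1 := by
    rw [integral_canonEns hψ hlam hp 0 m]
    simp only [one_mul]
    exact inv_mul_cancel₀ hZ.ne'
  rw [integral_const, smul_eq_mul, mul_one, measureReal_def] at h
  exact ⟨(ENNReal.toReal_eq_one_iff _).1 h⟩

end Ensemble

lemma isClosedEmbedding_slackPt {n : ℕ} (i : Fin (n + 1)) (s : ℝ) :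
    Topology.IsClosedEmbedding (slackPt i s) := by
  rw [funext (slackPt_eq_add i s)]
  exact (Homeomorph.addRight (slackPt i s 0)).isClosedEmbedding.comp
    (LinearMap.isClosedEmbedding_of_injective (LinearMap.ker_eq_bot.2 (slackLin_injective i)))

lemma hasFDerivAt_slackPt {n : ℕ} (i : Fin (n + 1)) (s : ℝ) (y : Fin n → ℝ) :
    HasFDerivAt (slackPt i s) (LinearMap.toContinuousLinearMap (slackLin i)) y := by
  rw [funext (slackPt_eq_add i s)]
  exact ((LinearMap.toContinuousLinearMap (slackLin i)).hasFDerivAt).add_const _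

/-- The orthogonal projection of `ℝᴺ` onto the vectors with vanishing coordinate sum. -/
def meanFree (N : ℕ) : EuclideanSpace ℝ (Fin N) →L[ℝ] EuclideanSpace ℝ (Fin N) :=
  LinearMap.toContinuousLinearMap
    { toFun := fun v => WithLp.toLp 2 fun i => v i - (∑ j, v j) / (N : ℝ)
      map_add' := fun v w => by
        ext i
        simp [Finset.sum_add_distrib]
        ring
      map_smul' := fun c v => by
        ext i
        simp [← Finset.mul_sum]
        ring }

lemma meanFree_apply {N : ℕ} (v : EuclideanSpace ℝ (Fin N)) (i : Fin N) :
    meanFree N v i = v i - (∑ j, v j) / (N : ℝ) := rfl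

lemma meanFree_slackLin {n : ℕ} (i : Fin (n + 1)) (h : Fin n → ℝ) :
    meanFree (n + 1) (slackLin i h) = slackLin i h := by
  ext j
  have : ∑ j, slackLin i h j = 0 := sum_slackPt i 0 h
  rw [meanFree_apply, this, zero_div, sub_zero]

/-- The norm of the tangential derivative of `f` along the hyperplanes `∑ xᵢ = const`. -/
def tanNorm {N : ℕ} (f : EuclideanSpace ℝ (Fin N) → ℝ) (x : EuclideanSpace ℝ (Fin N)) : ℝ :=
  ‖(fderiv ℝ f x).comp (meanFree N)‖

lemma tanNorm_nonneg {N : ℕ} (f : EuclideanSpace ℝ (Fin N) → ℝ) (x : EuclideanSpace ℝ (Fin N)) :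
    0 ≤ tanNorm f x := norm_nonneg _

lemma continuous_tanNorm {N : ℕ} {f : EuclideanSpace ℝ (Fin N) → ℝ} (hf : ContDiff ℝ 1 f) :
    Continuous (tanNorm f) :=
  ((hf.continuous_fderiv one_ne_zero).clm_comp continuous_const).norm

lemma hasCompactSupport_tanNorm {N : ℕ} {f : EuclideanSpace ℝ (Fin N) → ℝ}
    (hf : HasCompactSupport f) : HasCompactSupport (tanNorm f) := by
  refine (hf.fderiv ℝ).mono fun x hx h => hx ?_
  rw [tanNorm, h, ContinuousLinearMap.zero_comp, norm_zero]

lemma norm_fderiv_comp_slackPt_le {n : ℕ} (i : Fin (n + 1)) (s : ℝ)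
    {f : EuclideanSpace ℝ (Fin (n + 1)) → ℝ} (hf : ContDiff ℝ 1 f) (y : Fin n → ℝ) :
    ‖fderiv ℝ (fun y => f (slackPt i s y)) y‖ ≤
      ‖LinearMap.toContinuousLinearMap (slackLin i)‖ * tanNorm f (slackPt i s y) := by
  have h := ((hf.differentiable one_ne_zero _).hasFDerivAt.comp y
    (hasFDerivAt_slackPt i s y)).fderiv
  have h' : (fderiv ℝ f (slackPt i s y)).comp (LinearMap.toContinuousLinearMap (slackLin i)) =
      ((fderiv ℝ f (slackPt i s y)).comp (meanFree (n + 1))).comp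
        (LinearMap.toContinuousLinearMap (slackLin i)) := by
    ext h
    simp [meanFree_slackLin]
  rw [show (fun y => f (slackPt i s y)) = f ∘ slackPt i s from rfl, h, h', mul_comm]
  exact ContinuousLinearMap.opNorm_comp_le _ _

lemma tanNorm_mul_le {N : ℕ} {f g : EuclideanSpace ℝ (Fin N) → ℝ} (hf : ContDiff ℝ 1 f)
    (hg : ContDiff ℝ 1 g) (x : EuclideanSpace ℝ (Fin N)) :
    tanNorm (fun x => f x * g x) x ≤
      |g x| * tanNorm f x + |f x| * (‖fderiv ℝ g x‖ * ‖meanFree N‖) := by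
  have h := ((hf.differentiable one_ne_zero x).hasFDerivAt.mul
    (hg.differentiable one_ne_zero x).hasFDerivAt).fderiv
  rw [tanNorm, show (fun x => f x * g x) = f * g from rfl, h, ContinuousLinearMap.add_comp,
    ContinuousLinearMap.smul_comp, ContinuousLinearMap.smul_comp, add_comm]
  refine (norm_add_le _ _).trans (add_le_add ?_ ?_)
  · rw [norm_smul, norm_eq_abs, tanNorm]
  · rw [norm_smul, norm_eq_abs]
    exact mul_le_mul_of_nonneg_left (ContinuousLinearMap.opNorm_comp_le _ _) (abs_nonneg _)

lemma tanNorm_sq_le {N : ℕ} (f : EuclideanSpace ℝ (Fin N) → ℝ) (x : EuclideanSpace ℝ (Fin N)) :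
    tanNorm f x ^ 2 ≤ ∑ i, (gradient f x i - (∑ j, gradient f x j) / (N : ℝ)) ^ 2 := by
  set S := ∑ i, (gradient f x i - (∑ j, gradient f x j) / (N : ℝ)) ^ 2 with hS
  have hS0 : 0 ≤ S := Finset.sum_nonneg fun i _ => sq_nonneg _
  suffices h : tanNorm f x ≤ √S by
    calc tanNorm f x ^ 2 ≤ √S ^ 2 := pow_le_pow_left₀ (tanNorm_nonneg f x) h 2
      _ = S := Real.sq_sqrt hS0
  refine ContinuousLinearMap.opNorm_le_bound _ (Real.sqrt_nonneg _) fun v => ?_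
  have h1 : (fderiv ℝ f x) (meanFree N v) =
      ∑ i, (gradient f x i - (∑ j, gradient f x j) / (N : ℝ)) * v i := by
    rw [← inner_gradient_left, PiLp.inner_apply]
    simp only [meanFree_apply, RCLike.inner_apply, conj_trivial, sub_mul, Finset.sum_sub_distrib,
      ← Finset.mul_sum]
    congr 1
    · exact Finset.sum_congr rfl fun i _ => mul_comm _ _
    · ring
  rw [ContinuousLinearMap.comp_apply, h1, EuclideanSpace.norm_eq, norm_eq_abs]
  simp only [norm_eq_abs, sq_abs]
  rw [← Real.sqrt_mul hS0]
  exact Real.abs_le_sqrt (Finset.sum_mul_sq_le_sq_mul_sq _ _ _)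

lemma tanNorm_eq_zero {N : ℕ} {f : EuclideanSpace ℝ (Fin N) → ℝ} (hf : ∀ x, 0 ≤ f x)
    {x : EuclideanSpace ℝ (Fin N)} (hx : f x = 0) : tanNorm f x = 0 := by
  have hmin : IsLocalMin f x := Filter.Eventually.of_forall fun y => hx ▸ hf y
  rw [tanNorm, hmin.fderiv_eq_zero, ContinuousLinearMap.zero_comp, norm_zero]

lemma fisherX_nonneg {N : ℕ} {f : EuclideanSpace ℝ (Fin N) → ℝ} (hf : ∀ x, 0 ≤ f x)
    (x : EuclideanSpace ℝ (Fin N)) : 0 ≤ fisherX N f x := by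
  rw [fisherX]
  split_ifs
  · exact le_rfl
  · exact div_nonneg (Finset.sum_nonneg fun i _ => sq_nonneg _) (hf x)

lemma tanNorm_sq_le_fisherX_mul {N : ℕ} {f : EuclideanSpace ℝ (Fin N) → ℝ} (hf : ∀ x, 0 ≤ f x)
    (x : EuclideanSpace ℝ (Fin N)) : tanNorm f x ^ 2 ≤ fisherX N f x * f x := by
  by_cases hx : f x = 0
  · simp [tanNorm_eq_zero hf hx, hx]
  · rw [fisherX, if_neg hx, div_mul_cancel₀ _ hx]
    exact tanNorm_sq_le f x

/-- Cauchy–Schwarz for the tangential derivative of a probability density. -/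
lemma integrable_tanNorm_and_sq_integral_le {N : ℕ} {μ : Measure (EuclideanSpace ℝ (Fin N))}
    {f : EuclideanSpace ℝ (Fin N) → ℝ} (hf : ∀ x, 0 ≤ f x) (hf1 : ContDiff ℝ 1 f)
    (hfi : Integrable f μ) (hF : Integrable (fisherX N f) μ) (h1 : ∫ x, f x ∂μ = 1) :
    Integrable (tanNorm f) μ ∧ (∫ x, tanNorm f x ∂μ) ^ 2 ≤ ∫ x, fisherX N f x ∂μ := by
  have hbd : ∀ l : ℝ, ∀ x, 2 * l * tanNorm f x ≤ fisherX N f x + l ^ 2 * f x := by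
    intro l x
    have h := tanNorm_sq_le_fisherX_mul hf x
    have hF0 := fisherX_nonneg hf x
    have hf0 := hf x
    have h2 : (l * tanNorm f x) ^ 2 ≤ fisherX N f x * (l ^ 2 * f x) := by nlinarith [sq_nonneg l]
    have h3 : 0 ≤ l ^ 2 * f x := by positivity
    nlinarith [abs_le_of_sq_le_sq' (show (2 * (l * tanNorm f x)) ^ 2 ≤
      (fisherX N f x + l ^ 2 * f x) ^ 2 by nlinarith [sq_nonneg (fisherX N f x - l ^ 2 * f x)])
      (by positivity)]
  have hi : Integrable (tanNorm f) μ := by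
    refine (hF.add hfi).mono' (continuous_tanNorm hf1).aestronglyMeasurable
      (Filter.Eventually.of_forall fun x => ?_)
    rw [norm_eq_abs, abs_of_nonneg (tanNorm_nonneg f x), Pi.add_apply]
    have := hbd 1 x
    have := tanNorm_nonneg f x
    linarith
  refine ⟨hi, ?_⟩
  set b := ∫ x, tanNorm f x ∂μ with hb
  have h := integral_mono (μ := μ) (hi.const_mul (2 * b)) (hF.add (hfi.const_mul (b ^ 2))) (hbd b)
  simp only [Pi.add_apply] at h
  rw [integral_const_mul, integral_add hF (hfi.const_mul _), integral_const_mul, h1, ← hb] at h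
  nlinarith

lemma hasDerivAt_sitePot {n : ℕ} {ψ : ℝ → ℝ} (hψ : ContDiff ℝ 1 ψ) (a : Fin n → ℝ) (i : Fin n)
    (x : ℝ) : HasDerivAt (sitePot ψ a i) (deriv ψ x + a i) x := by
  have h := ((hψ.differentiable one_ne_zero x).hasDerivAt).add ((hasDerivAt_id x).const_mul (a i))
  rwa [mul_one] at h

lemma deriv_sitePot {n : ℕ} {ψ : ℝ → ℝ} (hψ : ContDiff ℝ 1 ψ) (a : Fin n → ℝ) (i : Fin n)
    (x : ℝ) : deriv (sitePot ψ a i) x = deriv ψ x + a i := (hasDerivAt_sitePot hψ a i x).deriv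

lemma PerturbedConvex.sitePot {lam B : ℝ} {ψ ψc : ℝ → ℝ} (h : PerturbedConvex lam B ψ ψc) {n : ℕ}
    (a : Fin n → ℝ) (i : Fin n) :
    PerturbedConvex lam B (sitePot ψ a i) (_root_.sitePot ψc a i) where
  smooth := h.smooth.add (contDiff_const.mul contDiff_id)
  smoothc := h.smoothc.add (contDiff_const.mul contDiff_id)
  mono x y hxy := by
    rw [deriv_sitePot h.smoothc, deriv_sitePot h.smoothc]
    have := h.mono x y hxy
    linarith
  close x := by
    simpa [_root_.sitePot] using h.close x
  dclose x := by
    rw [deriv_sitePot h.smooth, deriv_sitePot h.smoothc]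
    simpa using h.dclose x

section Covariance

variable {n : ℕ} {ψ ψc : ℝ → ℝ} {lam B : ℝ}

lemma integrable_deriv_canonEns (hlam : 0 < lam) (h : PerturbedConvex lam B ψ ψc)
    (a : Fin (n + 1) → ℝ) (m : ℝ) (i : Fin (n + 1)) :
    Integrable (fun x => deriv ψ (x i)) (canonEns ψ (n + 1) a m) := by
  have hp := fun i => h.sitePot a i
  rw [integrable_canonEns_iff h.smooth.continuous hlam hp i m]
  set s := ((n + 1 : ℕ) : ℝ) * m
  simp only [slackPt_same]
  have h1 : Integrable fun y : Fin n → ℝ => deriv (sitePot ψ a i) (s - ∑ j, y j) *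
      canWeight (sitePot ψ a i) (fun j => sitePot ψ a (i.succAbove j)) s y := by
    cases n with
    | zero => exact Integrable.of_finite
    | succ k => exact integrable_deriv_canWeight hlam (hp i) (fun j => hp (i.succAbove j)) s
  have h2 := integrable_canWeight hlam (hp i) (fun j => hp (i.succAbove j)) s
  refine (h1.sub (h2.const_mul (a i))).congr (Filter.Eventually.of_forall fun y => ?_)
  simp only [Pi.sub_apply]
  rw [deriv_sitePot h.smooth]
  ring

/-- The gradient bound for the covariance of a compactly supported function with the derivative of
`ψ` at one coordinate. -/
lemma exists_cov_deriv_le (hlam : 0 < lam) (h : PerturbedConvex lam B ψ ψc) (i : Fin (n + 1)) :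
    ∃ C, 0 ≤ C ∧ ∀ (m : ℝ) (a : Fin (n + 1) → ℝ) (f : EuclideanSpace ℝ (Fin (n + 1)) → ℝ),
      ContDiff ℝ 1 f → HasCompactSupport f →
      |covFn (canonEns ψ (n + 1) a m) f (fun x => deriv ψ (x i))| ≤
        C * ∫ x, tanNorm f x ∂(canonEns ψ (n + 1) a m) := by
  obtain ⟨C, hC, hcov⟩ := exists_canWeight_cov_le hlam h.nonneg n
  refine ⟨C * ‖LinearMap.toContinuousLinearMap (slackLin i)‖, by positivity, fun m a f hf hfc => ?_⟩
  have hp := fun i => h.sitePot a i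
  have hc := h.smooth.continuous
  have hprob := isProbabilityMeasure_canonEns hc hlam hp m
  set s := ((n + 1 : ℕ) : ℝ) * m with hs
  have hZ := partFn_pos hlam (hp i) (fun j => hp (i.succAbove j)) s
  set Z := partFn (sitePot ψ a i) (fun j => sitePot ψ a (i.succAbove j)) s with hZdef
  have hgs : HasCompactSupport fun y => f (slackPt i s y) :=
    hfc.comp_isClosedEmbedding (isClosedEmbedding_slackPt i s)
  have hgd : ContDiff ℝ 1 fun y => f (slackPt i s y) := by
    rw [funext fun y => congrArg f (slackPt_eq_add i s y)]
    exact hf.comp ((LinearMap.toContinuousLinearMap (slackLin i)).contDiff.add contDiff_const)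
  have hmain := hcov (hp i) (fun j => hp (i.succAbove j)) s _ hgd hgs
  have hfi : Integrable f (canonEns ψ (n + 1) a m) :=
    hf.continuous.integrable_of_hasCompactSupport hfc
  have hdc : Continuous fun x : EuclideanSpace ℝ (Fin (n + 1)) => deriv ψ (x i) :=
    h.continuous_deriv.comp (by fun_prop)
  have hfd : Integrable (fun x => f x * deriv ψ (x i)) (canonEns ψ (n + 1) a m) :=
    (hf.continuous.mul hdc).integrable_of_hasCompactSupport hfc.mul_right
  have hdi := integrable_deriv_canonEns hlam h a m i
  have hshift : covFn (canonEns ψ (n + 1) a m) f (fun x => deriv ψ (x i)) =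
      covFn (canonEns ψ (n + 1) a m) f (fun x => deriv (sitePot ψ a i) (x i)) := by
    simp only [covFn, deriv_sitePot h.smooth, mul_add]
    rw [integral_add hfd (hfi.mul_const _), integral_add hdi (integrable_const _),
      integral_mul_const, integral_const]
    simp
    ring
  have ht : ∫ y, ‖fderiv ℝ (fun y => f (slackPt i s y)) y‖ *
      canWeight (sitePot ψ a i) (fun j => sitePot ψ a (i.succAbove j)) s y ≤
      ‖LinearMap.toContinuousLinearMap (slackLin i)‖ * ∫ y, tanNorm f (slackPt i s y) *
      canWeight (sitePot ψ a i) (fun j => sitePot ψ a (i.succAbove j)) s y := by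
    rw [← integral_const_mul]
    refine integral_mono_of_nonneg (Filter.Eventually.of_forall fun y =>
      mul_nonneg (norm_nonneg _) (canWeight_pos _ _ _ _).le) (Integrable.const_mul ?_ _)
      (Filter.Eventually.of_forall fun y => ?_)
    · exact (integrable_canonEns_iff hc hlam hp i m).1
        ((continuous_tanNorm hf).integrable_of_hasCompactSupport (hasCompactSupport_tanNorm hfc))
    · simp only
      rw [← mul_assoc]
      exact mul_le_mul_of_nonneg_right (norm_fderiv_comp_slackPt_le i s hf y)
        (canWeight_pos _ _ _ _).le
  rw [hshift, covFn, integral_canonEns hc hlam hp i m, integral_canonEns hc hlam hp i m,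
    integral_canonEns hc hlam hp i m, integral_canonEns hc hlam hp i m, ← hs, ← hZdef]
  simp only [slackPt_same, mul_assoc]
  have hfac : ∀ P Q R : ℝ, Z⁻¹ * P - Z⁻¹ * (Q * (Z⁻¹ * R)) = (Z⁻¹ * Z⁻¹) * (Z * P - Q * R) := by
    intro P Q R
    field_simp
  rw [hfac, abs_mul, abs_of_pos (by positivity : 0 < Z⁻¹ * Z⁻¹)]
  calc _ ≤ Z⁻¹ * Z⁻¹ * (C * (Z * (‖LinearMap.toContinuousLinearMap (slackLin i)‖ *
        ∫ y, tanNorm f (slackPt i s y) *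
          canWeight (sitePot ψ a i) (fun j => sitePot ψ a (i.succAbove j)) s y))) := by
        refine mul_le_mul_of_nonneg_left (hmain.trans ?_) (by positivity)
        exact mul_le_mul_of_nonneg_left (mul_le_mul_of_nonneg_left ht hZ.le) hC
    _ = _ := by field_simp

/-- The gradient bound for the covariance of a compactly supported function with the mean
of the derivatives of `ψ` at the coordinates. -/
lemma exists_cov_mean_deriv_le_of_hasCompactSupport (hlam : 0 < lam)
    (h : PerturbedConvex lam B ψ ψc) (n : ℕ) :
    ∃ C, 0 ≤ C ∧ ∀ (m : ℝ) (a : Fin (n + 1) → ℝ) (f : EuclideanSpace ℝ (Fin (n + 1)) → ℝ),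
      ContDiff ℝ 1 f → HasCompactSupport f →
      |covFn (canonEns ψ (n + 1) a m) f
          (fun x => (1 / ((n + 1 : ℕ) : ℝ)) * ∑ i, deriv ψ (x i))| ≤
        C * ∫ x, tanNorm f x ∂(canonEns ψ (n + 1) a m) := by
  choose C hC hcov using fun i : Fin (n + 1) => exists_cov_deriv_le hlam h i
  refine ⟨(1 / ((n + 1 : ℕ) : ℝ)) * ∑ i, C i,
    mul_nonneg (by positivity) (Finset.sum_nonneg fun i _ => hC i), fun m a f hf hfc => ?_⟩
  have hprob := isProbabilityMeasure_canonEns h.smooth.continuous hlam (fun i => h.sitePot a i) m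
  have hdi := integrable_deriv_canonEns hlam h a m
  have hfd : ∀ i, Integrable (fun x => f x * deriv ψ (x i)) (canonEns ψ (n + 1) a m) := fun i =>
    (hf.continuous.mul (h.continuous_deriv.comp (by fun_prop))).integrable_of_hasCompactSupport
      hfc.mul_right
  have hsum : covFn (canonEns ψ (n + 1) a m) f
      (fun x => (1 / ((n + 1 : ℕ) : ℝ)) * ∑ i, deriv ψ (x i)) =
      (1 / ((n + 1 : ℕ) : ℝ)) *
        ∑ i, covFn (canonEns ψ (n + 1) a m) f (fun x => deriv ψ (x i)) := by
    simp only [covFn]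
    rw [integral_const_mul, integral_finsetSum _ fun i _ => hdi i, Finset.sum_sub_distrib,
      ← integral_finsetSum _ fun i _ => hfd i, ← Finset.mul_sum, mul_sub, ← integral_const_mul]
    congr 1
    · refine integral_congr_ae (Filter.Eventually.of_forall fun x => ?_)
      simp only [← Finset.mul_sum]
      ring
    · ring
  rw [hsum, abs_mul, abs_of_pos (by positivity : 0 < 1 / ((n + 1 : ℕ) : ℝ)), mul_assoc,
    Finset.sum_mul]
  exact mul_le_mul_of_nonneg_left ((Finset.abs_sum_le_sum_abs _ _).trans
    (Finset.sum_le_sum fun i _ => hcov i m a f hf hfc)) (by positivity)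

lemma exists_cov_mean_deriv_le (hlam : 0 < lam) (h : PerturbedConvex lam B ψ ψc) (n : ℕ) :
    ∃ C, 0 ≤ C ∧ ∀ (m : ℝ) (a : Fin (n + 1) → ℝ) (f : EuclideanSpace ℝ (Fin (n + 1)) → ℝ),
      ContDiff ℝ 1 f → Integrable f (canonEns ψ (n + 1) a m) →
      Integrable (fun x => f x * ((1 / ((n + 1 : ℕ) : ℝ)) * ∑ i, deriv ψ (x i)))
        (canonEns ψ (n + 1) a m) →
      Integrable (tanNorm f) (canonEns ψ (n + 1) a m) →
      |covFn (canonEns ψ (n + 1) a m) f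
          (fun x => (1 / ((n + 1 : ℕ) : ℝ)) * ∑ i, deriv ψ (x i))| ≤
        C * ∫ x, tanNorm f x ∂(canonEns ψ (n + 1) a m) := by
  obtain ⟨C, hC, hcov⟩ := exists_cov_mean_deriv_le_of_hasCompactSupport hlam h n
  refine ⟨C, hC, fun m a f hf hfi hfG ht => ?_⟩
  set μ := canonEns ψ (n + 1) a m
  set G : EuclideanSpace ℝ (Fin (n + 1)) → ℝ :=
    fun x => (1 / ((n + 1 : ℕ) : ℝ)) * ∑ i, deriv ψ (x i)
  let χ : ContDiffBump (0 : EuclideanSpace ℝ (Fin (n + 1))) := ⟨1, 2, one_pos, one_lt_two⟩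
  have hχ : ContDiff ℝ 1 χ := χ.contDiff
  obtain ⟨M, hM⟩ := (hχ.continuous_fderiv one_ne_zero).bounded_above_of_compact_support
    (χ.hasCompactSupport.fderiv ℝ)
  let r : ℕ → ℝ := fun k => 1 / ((k : ℝ) + 1)
  have hr : ∀ k, 0 < r k := fun k => by positivity
  have hr0 : Filter.Tendsto r Filter.atTop (nhds 0) := tendsto_one_div_add_atTop_nhds_zero_nat
  let χr : ℕ → EuclideanSpace ℝ (Fin (n + 1)) → ℝ := fun k x => χ (r k • x)
  have hχr : ∀ k, ContDiff ℝ 1 (χr k) := fun k => hχ.comp (contDiff_const_smul (r k))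
  have hχabs : ∀ k x, |χr k x| ≤ 1 := fun k x => by
    rw [abs_of_nonneg χ.nonneg]
    exact χ.le_one
  have hχlim : ∀ x, Filter.Tendsto (fun k => χr k x) Filter.atTop (nhds 1) := fun x => by
    have h1 : χ (0 : EuclideanSpace ℝ (Fin (n + 1))) = 1 :=
      χ.one_of_mem_closedBall (Metric.mem_closedBall_self zero_le_one)
    have h2 := (χ.continuous.tendsto (0 : EuclideanSpace ℝ (Fin (n + 1)))).comp
      ((hr0.smul_const x).trans_eq (by rw [zero_smul]) : Filter.Tendsto _ _ _)
    rwa [h1] at h2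
  have hχfd : ∀ k x, ‖fderiv ℝ (χr k) x‖ ≤ r k * M := fun k x => by
    rw [show χr k = fun x => χ (r k • x) from rfl, fderiv_comp_smul, norm_smul, norm_eq_abs,
      abs_of_pos (hr k)]
    exact mul_le_mul_of_nonneg_left (hM _) (hr k).le
  have hcs : ∀ k, HasCompactSupport fun x => f x * χr k x := fun k =>
    (χ.hasCompactSupport.comp_homeomorph (Homeomorph.smulOfNeZero (r k) (hr k).ne')).mul_left
  have hGc : Continuous G := by
    have := h.continuous_deriv
    fun_prop
  have hb : ∀ k, |covFn μ (fun x => f x * χr k x) G| ≤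
      C * ((∫ x, tanNorm f x ∂μ) + r k * ((M * ‖meanFree (n + 1)‖) * ∫ x, |f x| ∂μ)) := by
    intro k
    refine (hcov m a _ (hf.mul (hχr k)) (hcs k)).trans (mul_le_mul_of_nonneg_left ?_ hC)
    rw [← integral_const_mul, ← integral_const_mul, ← integral_add ht
      ((hfi.abs.const_mul _).const_mul _)]
    refine integral_mono_of_nonneg (Filter.Eventually.of_forall fun x => tanNorm_nonneg _ x)
      (ht.add ((hfi.abs.const_mul _).const_mul _)) (Filter.Eventually.of_forall fun x => ?_)
    refine (tanNorm_mul_le hf (hχr k) x).trans (add_le_add ?_ ?_)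
    · exact mul_le_of_le_one_left (tanNorm_nonneg f x) (hχabs k x)
    · calc |f x| * (‖fderiv ℝ (χr k) x‖ * ‖meanFree (n + 1)‖)
          ≤ |f x| * ((r k * M) * ‖meanFree (n + 1)‖) := by
            have := hχfd k x
            gcongr
        _ = _ := by ring
  have hl1 : Filter.Tendsto (fun k => ∫ x, f x * χr k x ∂μ) Filter.atTop (nhds (∫ x, f x ∂μ)) := by
    refine tendsto_integral_of_dominated_convergence (fun x => |f x|)
      (fun k => (hf.continuous.mul (hχr k).continuous).aestronglyMeasurable) hfi.abs
      (fun k => Filter.Eventually.of_forall fun x => ?_) (Filter.Eventually.of_forall fun x => ?_)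
    · rw [norm_eq_abs, abs_mul]
      exact mul_le_of_le_one_right (abs_nonneg _) (hχabs k x)
    · simpa using (hχlim x).const_mul (f x)
  have hl2 : Filter.Tendsto (fun k => ∫ x, f x * χr k x * G x ∂μ) Filter.atTop
      (nhds (∫ x, f x * G x ∂μ)) := by
    refine tendsto_integral_of_dominated_convergence (fun x => |f x * G x|)
      (fun k => ((hf.continuous.mul (hχr k).continuous).mul hGc).aestronglyMeasurable) hfG.abs
      (fun k => Filter.Eventually.of_forall fun x => ?_) (Filter.Eventually.of_forall fun x => ?_)
    · rw [norm_eq_abs, mul_right_comm, abs_mul]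
      exact mul_le_of_le_one_right (abs_nonneg _) (hχabs k x)
    · simpa using ((hχlim x).const_mul (f x)).mul_const (G x)
  have hlim := (hl2.sub (hl1.mul_const (∫ x, G x ∂μ))).abs
  have hlim' := (((hr0.mul_const ((M * ‖meanFree (n + 1)‖) * ∫ x, |f x| ∂μ)).const_add
    (∫ x, tanNorm f x ∂μ)).const_mul C)
  rw [zero_mul, add_zero] at hlim'
  exact le_of_tendsto_of_tendsto' hlim hlim' hb

end Covariance

lemma perturbedConvex_of_split {ψ ψc δψ : ℝ → ℝ} {lam B : ℝ} (hψ : ContDiff ℝ 2 ψ)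
    (hψc : ContDiff ℝ 2 ψc) (hsplit : ∀ x, ψ x = ψc x + δψ x)
    (hconv : ∀ x, lam ≤ deriv (deriv ψc) x) (hbnd : ∀ x, |δψ x| + |deriv δψ x| ≤ B) :
    PerturbedConvex lam B ψ ψc := by
  have h1 : ContDiff ℝ 1 ψ := hψ.of_le one_le_two
  have h1c : ContDiff ℝ 1 ψc := hψc.of_le one_le_two
  have hδ : δψ = ψ - ψc := by
    funext x
    simp [hsplit x]
  have hd : ∀ x, deriv δψ x = deriv ψ x - deriv ψc x := fun x => by
    rw [hδ, deriv_sub (h1.differentiable one_ne_zero x) (h1c.differentiable one_ne_zero x)]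
  have hdc : Differentiable ℝ (deriv ψc) :=
    (((contDiff_succ_iff_deriv (n := 1)).1 hψc).2.2).differentiable one_ne_zero
  refine ⟨h1, h1c, fun x y hxy => ?_, fun x => ?_, fun x => ?_⟩
  · exact Convex.mul_sub_le_image_sub_of_le_deriv convex_univ hdc.continuous.continuousOn
      hdc.differentiableOn (fun x _ => hconv x) x trivial y trivial hxy
  · have := hbnd x
    have := abs_nonneg (deriv δψ x)
    rw [hsplit x, add_sub_cancel_left]
    linarith
  · rw [← hd]
    have := hbnd x
    have := abs_nonneg (δψ x)
    linarith

/-- For every fixed system size `K̃` there is a constant `C(K̃)` (depending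
on `K̃`, `ψ`, `L`) such that
`|cov(f, (1/K̃)∑ψ'(xᵢ))|² ≤ C(K̃) ∫ |∇f|²/f dμ_{K̃,a,m}` for all probability densities `f`. -/
theorem statement7
    (ψ ψc δψ : ℝ → ℝ) (lam0 B L : ℝ)
    (hlam0 : 0 < lam0) (hL : 0 < L)
    (hψ : ContDiff ℝ 2 ψ) (hψc : ContDiff ℝ 2 ψc) (hδψ : ContDiff ℝ 1 δψ)
    (hsplit : ∀ x, ψ x = ψc x + δψ x)
    (hconv : ∀ x, lam0 ≤ deriv (deriv ψc) x)
    (hbnd : ∀ x, |δψ x| + |deriv δψ x| ≤ B) :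
    ∀ Kt : ℕ, ∃ C : ℝ, 0 < C ∧ ∀ (m : ℝ) (a : Fin Kt → ℝ), (∀ i, |a i| ≤ L) →
      ∀ f : EuclideanSpace ℝ (Fin Kt) → ℝ, ContDiff ℝ (⊤ : ℕ∞) f → (∀ x, 0 ≤ f x) →
        Integrable f (canonEns ψ Kt a m) →
        (∫ x, f x ∂(canonEns ψ Kt a m)) = 1 →
        Integrable (fun x => f x * ((1 / (Kt : ℝ)) * ∑ i, deriv ψ (x i))) (canonEns ψ Kt a m) →
        Integrable (fun x => (1 / (Kt : ℝ)) * ∑ i, deriv ψ (x i)) (canonEns ψ Kt a m) →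
        Integrable (fisherX Kt f) (canonEns ψ Kt a m) →
        (covFn (canonEns ψ Kt a m) f (fun x => (1 / (Kt : ℝ)) * ∑ i, deriv ψ (x i))) ^ 2
          ≤ C * ∫ x, fisherX Kt f x ∂(canonEns ψ Kt a m) := by
  have h := perturbedConvex_of_split hψ hψc hsplit hconv hbnd
  intro Kt
  cases Kt with
  | zero =>
    refine ⟨1, one_pos, fun m a _ f _ hf0 _ _ _ _ _ => ?_⟩
    have h0 : 0 ≤ ∫ x, fisherX 0 f x ∂(canonEns ψ 0 a m) :=
      integral_nonneg (fisherX_nonneg hf0)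
    simpa [covFn] using h0
  | succ n =>
    obtain ⟨C, hC, hcov⟩ := exists_cov_mean_deriv_le hlam0 h n
    refine ⟨C ^ 2 + 1, by positivity, fun m a _ f hf hf0 hfi h1 hfG _ hF => ?_⟩
    have hf1 : ContDiff ℝ 1 f := hf.of_le (by exact_mod_cast le_top)
    obtain ⟨ht, hsq⟩ := integrable_tanNorm_and_sq_integral_le hf0 hf1 hfi hF h1
    have hI : 0 ≤ ∫ x, fisherX (n + 1) f x ∂(canonEns ψ (n + 1) a m) :=
      integral_nonneg (fisherX_nonneg hf0)
    have hb := pow_le_pow_left₀ (abs_nonneg _) (hcov m a f hf1 hfi hfG ht) 2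
    rw [sq_abs, mul_pow] at hb
    calc _ ≤ _ := hb
      _ ≤ C ^ 2 * ∫ x, fisherX (n + 1) f x ∂(canonEns ψ (n + 1) a m) :=
        mul_le_mul_of_nonneg_left hsq (sq_nonneg C)
      _ ≤ _ := mul_le_mul_of_nonneg_right (le_add_of_nonneg_right zero_le_one) hI
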